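/- Fix k ≥ 2 and let ε = k−1 if k is even and ε = k−2 if k is odd. There is a constant C > 0 such that for all sufficiently large n and every subset A of the alternating group A_n, | #{(σ_1,…,σ_k) ∈ S_n^k : w_c(σ_1,…,σ_k) ∈ A}/(n!)^k − #A/#A_n | ≤ C/n^ε. That is, the total variation distance between P_{w_c,n,2k} and the uniform measure on A_n is O(n^{−(k−1)}) for even k and O(n^{−(k−2)}) for odd k. -/

import Mathlib

/-- `w_c(σ_1, …, σ_k) = σ_1 ⋯ σ_k · σ_1⁻¹ ⋯ σ_k⁻¹`. -/
def wc {n k : ℕ} (v : Fin k → Equiv.Perm (Fin n)) : Equiv.Perm (Fin n) :=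
  (List.ofFn v).prod * (List.ofFn fun i => (v i)⁻¹).prod

open Finset


section Fourier
variable {G : Type*} [Group G] [Fintype G] {m : ℕ} {d : Fin m → ℕ}
  (φ : MonoidAlgebra ℂ G ≃ₐ[ℂ] Π i, Matrix (Fin (d i)) (Fin (d i)) ℂ)

/-- matrix of a group element in block `i` -/
noncomputable def rp (i : Fin m) : G →* Matrix (Fin (d i)) (Fin (d i)) ℂ where
  toFun g := φ (MonoidAlgebra.single g 1) i
  map_one' := by
    have : (MonoidAlgebra.single (1 : G) (1 : ℂ)) = 1 := rfl
    rw [this, map_one]; rfl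
  map_mul' a b := by
    have : (MonoidAlgebra.single (a * b) (1 : ℂ)) =
      MonoidAlgebra.single a 1 * MonoidAlgebra.single b 1 := by
      rw [MonoidAlgebra.single_mul_single, one_mul]
    rw [this, map_mul]; rfl

lemma phi_sum (x : MonoidAlgebra ℂ G) (i : Fin m) :
    φ x i = ∑ g, x.coeff g • rp φ i g := by
  have hx : x = ∑ g, x.coeff g • MonoidAlgebra.single g (1 : ℂ) := by
    ext h
    classical
    simp
  conv_lhs => rw [hx]
  rw [map_sum, Finset.sum_apply]
  simp only [map_smul, Pi.smul_apply]
  rfl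

lemma reg_trace (x : MonoidAlgebra ℂ G) :
    (Fintype.card G : ℂ) * x.coeff 1 = ∑ i, (d i : ℂ) * (φ x i).trace := by
  classical
  have h1 : LinearMap.trace ℂ (MonoidAlgebra ℂ G) (LinearMap.mulLeft ℂ x)
      = (Fintype.card G : ℂ) * x.coeff 1 := by
    rw [LinearMap.trace_eq_matrix_trace ℂ
      (Module.Basis.ofRepr (MonoidAlgebra.coeffLinearEquiv (M := G) (S := ℂ) ℂ)), Matrix.trace]
    rw [Finset.sum_congr rfl (g := fun _ => x.coeff 1)]
    · simp
    · intro g _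
      rw [Matrix.diag_apply, LinearMap.toMatrix_apply]
      have : (Module.Basis.ofRepr (MonoidAlgebra.coeffLinearEquiv (M := G) (S := ℂ) ℂ)) g
        = MonoidAlgebra.single g 1 := rfl
      rw [this]
      change (x * MonoidAlgebra.single g 1).coeff g = _
      simp 
  have h2 : LinearMap.trace ℂ _ (LinearMap.mulLeft ℂ (φ x)) = ∑ i, (d i : ℂ) * (φ x i).trace := by
    rw [LinearMap.trace_eq_matrix_trace ℂ (Pi.basis (fun i => Matrix.stdBasis ℂ (Fin (d i)) (Fin (d i))))]
    rw [Matrix.trace, Fintype.sum_sigma]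
    refine Finset.sum_congr rfl fun i _ => ?_
    rw [Fintype.sum_prod_type]
    rw [Matrix.trace, Finset.mul_sum]
    refine Finset.sum_congr rfl fun a _ => ?_
    rw [Finset.sum_congr rfl (g := fun _ => φ x i a a)]
    · simp
    · intro b _
      rw [Matrix.diag_apply, LinearMap.toMatrix_apply, Pi.basis_apply, Pi.basis_repr]
      have hz : (LinearMap.mulLeft ℂ (φ x)) (Pi.single i ((Matrix.stdBasis ℂ (Fin (d i)) (Fin (d i))) (a, b))) i
          = φ x i * Matrix.single a b 1 := by
        rw [LinearMap.mulLeft_apply, Pi.mul_apply, Pi.single_eq_same, Matrix.stdBasis_eq_single]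
      simp only
      rw [hz]
      have hr : ∀ M : Matrix (Fin (d i)) (Fin (d i)) ℂ,
        (Matrix.stdBasis ℂ (Fin (d i)) (Fin (d i))).repr M (a, b) = M a b := fun M => rfl
      rw [hr]
      simp
  rw [← h1, ← h2, ← LinearMap.trace_conj' _ φ.toLinearEquiv]
  congr 1
  refine LinearMap.ext fun y => ?_
  simp [LinearEquiv.conj_apply]

end Fourier


section Fourier
variable {G : Type*} [Group G] [Fintype G] {m : ℕ} {d : Fin m → ℕ}
  (φ : MonoidAlgebra ℂ G ≃ₐ[ℂ] Π i, Matrix (Fin (d i)) (Fin (d i)) ℂ)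

lemma comm_scalar (i : Fin m) (M : Matrix (Fin (d i)) (Fin (d i)) ℂ)
    (h : ∀ g, rp φ i g * M = M * rp φ i g) : ∃ c : ℂ, M = c • (1 : Matrix (Fin (d i)) (Fin (d i)) ℂ) := by
  classical
  have h2 : ∀ N : Matrix (Fin (d i)) (Fin (d i)) ℂ, N * M = M * N := by
    intro N
    have hN : N = φ (φ.symm (Pi.single i N)) i := by simp
    rw [hN, phi_sum, Finset.sum_mul, Finset.mul_sum]
    refine Finset.sum_congr rfl fun g _ => ?_
    rw [smul_mul_assoc, mul_smul_comm, h]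
  have := Matrix.mem_range_scalar_of_commute_single (M := M) (fun a b _ => h2 _)
  obtain ⟨c, hc⟩ := this
  refine ⟨c, ?_⟩
  rw [← hc, Matrix.smul_one_eq_diagonal]; rfl

lemma sum_conj (i : Fin m) (hd : d i ≠ 0) (M : Matrix (Fin (d i)) (Fin (d i)) ℂ) :
    ∑ a, rp φ i a * M * rp φ i a⁻¹ = ((Fintype.card G : ℂ) * M.trace / d i) • 1 := by
  obtain ⟨c, hc⟩ := comm_scalar φ i (∑ a, rp φ i a * M * rp φ i a⁻¹) (by
    intro g
    rw [Finset.sum_mul, Finset.mul_sum]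
    refine Fintype.sum_equiv (Equiv.mulLeft g) _ _ fun a => ?_
    simp only [Equiv.coe_mulLeft, map_mul, mul_inv_rev, mul_assoc]
    rw [← map_mul, inv_mul_cancel, map_one, mul_one])
  have ht := congrArg Matrix.trace hc
  rw [Matrix.trace_sum, Finset.sum_congr rfl (g := fun _ => M.trace)] at ht
  · rw [hc]
    congr 1
    have hd' : (d i : ℂ) ≠ 0 := by exact_mod_cast hd
    field_simp
    simp [Matrix.trace_smul] at ht
    rw [ht]
  · intro a _
    rw [Matrix.trace_mul_cycle, ← map_mul, inv_mul_cancel, map_one, one_mul]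

lemma sum_char (i : Fin m) (hd : d i ≠ 0) :
    ∑ b, (rp φ i b).trace • rp φ i b⁻¹ = ((Fintype.card G : ℂ) / d i) • 1 := by
  classical
  have hd' : (d i : ℂ) ≠ 0 := by exact_mod_cast hd
  have hG : (Fintype.card G : ℂ) ≠ 0 := by exact_mod_cast Fintype.card_ne_zero
  set x := φ.symm (Pi.single i 1) with hx
  have hc : ∀ a, (Fintype.card G : ℂ) * x.coeff a = d i * (rp φ i a⁻¹).trace := by
    intro a
    have := reg_trace φ (MonoidAlgebra.single a⁻¹ 1 * x)
    have h2 : (MonoidAlgebra.single a⁻¹ 1 * x).coeff 1 = x.coeff a := by simp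
    rw [h2] at this
    rw [this, Finset.sum_eq_single i]
    · rw [map_mul, hx]; simp; left; rfl
    · intro j _ hj
      rw [map_mul, hx]; simp [hj]
    · simp
  have h1 : φ x i = 1 := by simp [hx]
  rw [phi_sum] at h1
  have h3 : ∑ b, (rp φ i b).trace • rp φ i b⁻¹ = ∑ b, (rp φ i b⁻¹).trace • rp φ i b :=
    Fintype.sum_equiv (Equiv.inv G) _ _ fun b => by simp
  rw [h3, ← h1, Finset.smul_sum]
  refine Finset.sum_congr rfl fun b _ => ?_
  rw [smul_smul]
  congr 1
  have := hc b
  field_simp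
  rw [this]; ring

/-- general word map -/
def wcG {G : Type*} [Group G] {k : ℕ} (v : Fin k → G) : G :=
  (List.ofFn v).prod * (List.ofFn fun i => (v i)⁻¹).prod

lemma sum_wcG (i : Fin m) (hd : d i ≠ 0) (k : ℕ) :
    ∑ v : Fin k → G, rp φ i (wcG v) =
      ((Fintype.card G : ℂ) ^ k / (d i : ℂ) ^ (2 * (k / 2))) • 1 := by
  have hd' : (d i : ℂ) ≠ 0 := by exact_mod_cast hd
  induction k using Nat.twoStepInduction with
  | zero => simp [wcG]
  | one => simp [wcG, ← Nat.cast_smul_eq_nsmul ℂ]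
  | more k ih _ =>
    have e1 : ∑ v : Fin (k+2) → G, rp φ i (wcG v) = ∑ v : Fin k → G, ∑ b : G, ∑ a : G,
        rp φ i (wcG (Fin.cons a (Fin.cons b v : Fin (k+1) → G) : Fin (k+2) → G)) := by
      rw [← (Fin.consEquiv (fun _ : Fin (k+2) => G)).sum_comp, Fintype.sum_prod_type_right,
        ← (Fin.consEquiv (fun _ : Fin (k+1) => G)).sum_comp, Fintype.sum_prod_type_right]
      rfl
    rw [e1]
    have e2 : ∀ v : Fin k → G, ∑ b : G, ∑ a : G,
        rp φ i (wcG (Fin.cons a (Fin.cons b v : Fin (k+1) → G) : Fin (k+2) → G))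
        = ((Fintype.card G : ℂ) ^ 2 / (d i) ^ 2) • rp φ i (wcG v) := by
      intro v
      set S := (List.ofFn v).prod with hS
      set S' := (List.ofFn fun i => (v i)⁻¹).prod with hS'
      have e3 : ∀ a b, wcG (Fin.cons a (Fin.cons b v : Fin (k+1) → G) : Fin (k+2) → G)
          = a * (b * S) * a⁻¹ * (b⁻¹ * S') := by
        intro a b
        simp [wcG, List.ofFn_succ, ← hS, ← hS', mul_assoc]
      have e4 : ∀ b, ∑ a : G, rp φ i (wcG (Fin.cons a (Fin.cons b v : Fin (k+1) → G) : Fin (k+2) → G))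
          = ((Fintype.card G : ℂ) * (rp φ i (b * S)).trace / d i) • rp φ i (b⁻¹ * S') := by
        intro b
        simp_rw [e3, map_mul _ (_ * _ * _) (b⁻¹ * S'), map_mul _ (_ * (b * S)) _, map_mul _ _ (b * S)]
        rw [← Finset.sum_mul, sum_conj φ i hd]
        simp
      simp_rw [e4]
      have e5 : ∑ b : G, ((Fintype.card G : ℂ) * (rp φ i (b * S)).trace / d i) • rp φ i (b⁻¹ * S')
          = ∑ b : G, ((Fintype.card G : ℂ) / d i) • (rp φ i S * ((rp φ i b).trace • rp φ i b⁻¹) * rp φ i S') := by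
        refine Fintype.sum_equiv (Equiv.mulRight S) _ _ fun b => ?_
        simp only [Equiv.coe_mulRight, mul_inv_rev, mul_smul_comm, smul_mul_assoc, smul_smul, ← map_mul]
        congr 1
        · ring
        · congr 1; group
      rw [e5, ← Finset.smul_sum, ← Finset.sum_mul, ← Finset.mul_sum, sum_char φ i hd]
      simp only [mul_smul_comm, smul_mul_assoc, smul_smul, mul_one, ← map_mul]
      congr 1
      ring
    simp_rw [e2]
    rw [← Finset.smul_sum, ih, smul_smul]
    congr 1
    have : (k + 2) / 2 = k / 2 + 1 := by omega
    rw [this]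
    field_simp
    ring

lemma wcG_inv {G : Type*} [Group G] {k : ℕ} (v : Fin k → G) :
    (wcG v)⁻¹ = wcG (v ∘ Fin.rev) := by
  have h1 : ∀ u : Fin k → G, (List.ofFn u).prod⁻¹ = (List.ofFn fun i => (u (Fin.rev i))⁻¹).prod := by
    intro u
    rw [List.prod_inv_reverse]
    congr 1
    apply List.ext_getElem
    · simp
    · intro j h1 h2
      simp
      simp at h1
      refine congrArg u (Fin.ext ?_)
      simp only [Fin.val_rev]
      omega
  rw [wcG, mul_inv_rev, h1, h1]
  simp [wcG]
  rfl

theorem fourier_bound (hd : ∀ i, d i ≠ 0) (H : Subgroup G) [H.Normal] (k : ℕ)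
    (hw : ∀ v : Fin k → G, wcG v ∈ H) (A : Set G) (hA : A ⊆ (H : Set G))
    (I : Finset (Fin m)) (hI : ∀ i, i ∉ I → ∀ h ∈ H, rp φ i h = 1)
    (hI' : ∀ i ∈ I, ∃ h ∈ H, rp φ i h ≠ 1) :
    ((Nat.card {v : Fin k → G // wcG v ∈ A} : ℝ) / (Fintype.card G : ℝ) ^ k
      - (Nat.card A : ℝ) / (Nat.card H : ℝ)) ^ 2
    ≤ ∑ i ∈ I, (d i : ℝ) ^ 2 / (d i : ℝ) ^ (4 * (k / 2)) := by
  classical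
  have hG : (Fintype.card G : ℝ) ≠ 0 := by exact_mod_cast Fintype.card_ne_zero
  have hGc : (Fintype.card G : ℂ) ≠ 0 := by exact_mod_cast Fintype.card_ne_zero
  have hH : (Nat.card H : ℝ) ≠ 0 := by exact_mod_cast Nat.card_pos.ne'
  have hHc : (Nat.card H : ℂ) ≠ 0 := by exact_mod_cast Nat.card_pos.ne'
  let N : G → ℝ := fun g => ∑ v : Fin k → G, if wcG v = g then 1 else 0
  let f : G → ℝ := fun g => N g / (Fintype.card G : ℝ) ^ k - (if g ∈ H then 1 else 0) / (Nat.card H : ℝ)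
  have hNinv : ∀ g, N g⁻¹ = N g := by
    intro g
    refine Fintype.sum_equiv ((Equiv.arrowCongr Fin.revPerm (Equiv.refl G))) _ _ fun v => ?_
    have : wcG (((Equiv.arrowCongr Fin.revPerm (Equiv.refl G))) v) = (wcG v)⁻¹ := by
      rw [wcG_inv]; rfl
    rw [this, inv_eq_iff_eq_inv]
  have hfinv : ∀ g, f g⁻¹ = f g := by
    intro g; simp only [f, hNinv, inv_mem_iff]
  let x : MonoidAlgebra ℂ G := (MonoidAlgebra.coeffLinearEquiv (M := G) (S := ℂ) ℂ).symm
    (Finsupp.equivFunOnFinite.symm fun g => (f g : ℂ))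
  have hxc : ∀ g, x.coeff g = (f g : ℂ) := fun g => rfl
  have hxi : ∀ i, φ x i = if i ∈ I then (1 / (d i : ℂ) ^ (2 * (k/2))) • (1 : Matrix (Fin (d i)) (Fin (d i)) ℂ) else 0 := by
    intro i
    have h1 : φ x i = (1 / (Fintype.card G : ℂ) ^ k) • ∑ v : Fin k → G, rp φ i (wcG v)
        - (1 / (Nat.card H : ℂ)) • ∑ g, (if g ∈ H then rp φ i g else 0) := by
      rw [phi_sum, Finset.smul_sum, Finset.smul_sum]
      have : ∑ v : Fin k → G, (1 / (Fintype.card G : ℂ) ^ k) • rp φ i (wcG v)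
        = ∑ g, (1 / (Fintype.card G : ℂ) ^ k) • ((N g : ℂ) • rp φ i g) := by
        rw [← Finset.smul_sum, ← Finset.smul_sum]
        congr 1
        simp only [N]
        push_cast
        simp_rw [Finset.sum_smul]
        rw [Finset.sum_comm]
        refine Finset.sum_congr rfl fun v _ => ?_
        simp
      rw [this, ← Finset.sum_sub_distrib]
      refine Finset.sum_congr rfl fun g _ => ?_
      rw [hxc]
      simp only [f]
      push_cast
      rw [sub_smul, smul_smul]
      congr 1
      · congr 1; ring
      · split_ifs <;> simp
    split_ifs with hi
    · rw [h1, sum_wcG φ i (hd i)]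
      have h2 : ∑ g, (if g ∈ H then rp φ i g else 0) = 0 := by
        obtain ⟨c, hc⟩ := comm_scalar φ i (∑ g, (if g ∈ H then rp φ i g else 0)) (by
          intro g
          rw [Finset.sum_mul, Finset.mul_sum]
          refine Fintype.sum_equiv (MulAut.conj g).toEquiv _ _ fun a => ?_
          have : (MulAut.conj g) a ∈ H ↔ a ∈ H := by
            rw [MulAut.conj_apply]; exact (Subgroup.Normal.mem_comm_iff inferInstance).trans (by simp)
          simp only [MulEquiv.toEquiv_eq_coe, EquivLike.coe_coe, this]
          split_ifs
          · rw [← map_mul, ← map_mul]; simp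
          · simp)
        by_cases h0 : c = 0
        · rw [hc, h0, zero_smul]
        exfalso
        obtain ⟨h, hh, hne⟩ := hI' i hi
        apply hne
        have h3 : rp φ i h * (∑ g, (if g ∈ H then rp φ i g else 0)) = ∑ g, (if g ∈ H then rp φ i g else 0) := by
          rw [Finset.mul_sum]
          refine Fintype.sum_equiv (Equiv.mulLeft h) _ _ fun a => ?_
          simp only [Equiv.coe_mulLeft, H.mul_mem_cancel_left hh]
          split_ifs <;> simp
        rw [hc, mul_smul_comm, mul_one] at h3
        exact smul_right_injective _ h0 h3
      rw [h2, smul_zero, sub_zero, smul_smul]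
      congr 1
      field_simp
    · rw [h1]
      have hi' := hI i hi
      have h2 : ∀ g, (if g ∈ H then rp φ i g else 0) = if g ∈ H then 1 else 0 := by
        intro g; split_ifs with hg
        · exact hi' g hg
        · rfl
      simp_rw [fun v : Fin k → G => hi' _ (hw v), h2]
      have h3 : (∑ g, if g ∈ H then (1 : Matrix (Fin (d i)) (Fin (d i)) ℂ) else 0) = (Nat.card H : ℂ) • 1 := by
        rw [← Finset.sum_filter, Finset.sum_const, ← Nat.cast_smul_eq_nsmul ℂ]
        congr 2
        rw [Nat.card_eq_fintype_card, Fintype.card_subtype]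
      rw [h3, smul_smul, Finset.sum_const, ← Nat.cast_smul_eq_nsmul ℂ, smul_smul]
      simp [hHc, hGc]
  have hpars : (Fintype.card G : ℝ) * ∑ g, f g ^ 2 = ∑ i ∈ I, (d i : ℝ) ^ 2 / (d i : ℝ) ^ (4 * (k / 2)) := by
    have h1 := reg_trace φ (x * x)
    have h2 : (x * x).coeff 1 = ∑ g, ((f g ^ 2 : ℝ) : ℂ) := by
      have hx : x = ∑ g, (f g : ℂ) • MonoidAlgebra.single g (1 : ℂ) := by
        ext h
        simp [hxc, Finsupp.single_apply]
      have hxx : x * x = (∑ g, (f g : ℂ) • MonoidAlgebra.single g (1 : ℂ)) * x := by rw [← hx]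
      rw [hxx, Finset.sum_mul]
      simp only [MonoidAlgebra.coeff_sum, Finsupp.finsetSum_apply]
      refine Finset.sum_congr rfl fun g _ => ?_
      simp [hxc, hfinv]
      ring
    rw [h2] at h1
    apply Complex.ofReal_injective
    push_cast at h1 ⊢
    rw [h1, ← Finset.sum_subset (Finset.subset_univ I)]
    · refine Finset.sum_congr rfl fun i hi => ?_
      have hd' : (d i : ℂ) ≠ 0 := by exact_mod_cast hd i
      rw [map_mul, Pi.mul_apply, hxi, if_pos hi]
      simp only [mul_smul_comm, smul_mul_assoc, smul_smul, mul_one, Matrix.trace_smul, Matrix.trace_one]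
      simp
      field_simp
      rw [← pow_mul]; congr 1; ring
    · intro i _ hi
      rw [map_mul, Pi.mul_apply, hxi, if_neg hi]; simp
  rw [← hpars]
  have hs : (Nat.card {v : Fin k → G // wcG v ∈ A} : ℝ) / (Fintype.card G : ℝ) ^ k
      - (Nat.card A : ℝ) / (Nat.card H : ℝ) = ∑ g ∈ univ.filter (· ∈ A), f g := by
    simp only [f]
    rw [Finset.sum_sub_distrib, ← Finset.sum_div, ← Finset.sum_div]
    congr 2
    · simp only [N]
      rw [Finset.sum_comm, Nat.card_eq_fintype_card, Fintype.card_subtype, Finset.card_filter]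
      push_cast
      refine Finset.sum_congr rfl fun v _ => ?_
      simp [Finset.sum_ite_eq]
    · rw [Finset.sum_congr rfl (g := fun _ => (1 : ℝ))]
      · simp [Nat.card_eq_fintype_card, Fintype.card_subtype]
      · intro g hg
        have : g ∈ H := hA (by simpa using hg)
        rw [if_pos this]
  rw [hs]
  calc (∑ g ∈ univ.filter (· ∈ A), f g) ^ 2 ≤ (univ.filter (· ∈ A)).card * ∑ g ∈ univ.filter (· ∈ A), f g ^ 2 :=
        sq_sum_le_card_mul_sum_sq
    _ ≤ (Fintype.card G : ℝ) * ∑ g, f g ^ 2 := by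
        gcongr
        · exact Finset.card_le_univ _
        · exact Finset.subset_univ _

end Fourier


/-- Maya states -/
abbrev MSt := ℤ → Bool

def vac : MSt := fun x => decide (x ≤ 0)
def mv (c : ℤ) (S : MSt) : MSt := fun x => if x = c then S (c+1) else if x = c + 1 then S c else S x
def Ad (c : ℤ) (S : MSt) : Prop := S c = true ∧ S (c+1) = false
def Rm (c : ℤ) (S : MSt) : Prop := S c = false ∧ S (c+1) = true

instance (c : ℤ) (S : MSt) : Decidable (Ad c S) := by unfold Ad; infer_instance
instance (c : ℤ) (S : MSt) : Decidable (Rm c S) := by unfold Rm; infer_instance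

def Reach : ℕ → MSt → Prop
  | 0, S => S = vac
  | m+1, S => ∃ c μ, Reach m μ ∧ Ad c μ ∧ S = mv c μ

lemma mv_self (c : ℤ) (S : MSt) : mv c S c = S (c+1) := by simp [mv]
lemma mv_succ (c : ℤ) (S : MSt) : mv c S (c+1) = S c := by simp [mv]
lemma mv_ne (c x : ℤ) (S : MSt) (h1 : x ≠ c) (h2 : x ≠ c + 1) : mv c S x = S x := by simp [mv, h1, h2]

lemma mv_mv (c : ℤ) (S : MSt) : mv c (mv c S) = S := by
  funext x
  by_cases h1 : x = c
  · subst h1; rw [mv_self, mv_succ]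
  by_cases h2 : x = c + 1
  · subst h2; rw [mv_succ, mv_self]
  rw [mv_ne _ _ _ h1 h2, mv_ne _ _ _ h1 h2]

lemma mv_comm (c d : ℤ) (S : MSt) (h1 : d ≠ c) (h2 : d ≠ c + 1) (h3 : c ≠ d + 1) :
    mv c (mv d S) = mv d (mv c S) := by
  funext x
  simp only [mv]
  split_ifs <;> first | rfl | omega

lemma rm_mv {c : ℤ} {S : MSt} (h : Ad c S) : Rm c (mv c S) := by
  unfold Rm; rw [mv_self, mv_succ]; exact ⟨h.2, h.1⟩
lemma ad_mv {c : ℤ} {S : MSt} (h : Rm c S) : Ad c (mv c S) := by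
  unfold Ad; rw [mv_self, mv_succ]; exact ⟨h.2, h.1⟩

lemma rm_far {c d : ℤ} {S : MSt} (h1 : d ≠ c) (h2 : d ≠ c + 1) (h3 : c ≠ d + 1) :
    Rm d (mv c S) ↔ Rm d S := by
  unfold Rm
  rw [mv_ne _ _ _ h1 h2, mv_ne _ _ _ (by omega) (by omega)]
lemma ad_far {c d : ℤ} {S : MSt} (h1 : d ≠ c) (h2 : d ≠ c + 1) (h3 : c ≠ d + 1) :
    Ad d (mv c S) ↔ Ad d S := by
  unfold Ad
  rw [mv_ne _ _ _ h1 h2, mv_ne _ _ _ (by omega) (by omega)]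

lemma rm_rm_far {c d : ℤ} {S : MSt} (hc : Rm c S) (hd : Rm d S) (h : d ≠ c) :
    d ≠ c + 1 ∧ c ≠ d + 1 := by
  constructor
  · rintro rfl
    have := hc.2; rw [hd.1] at this; simp at this
  · rintro rfl
    have := hd.2; rw [hc.1] at this; simp at this

lemma reach_rm {m : ℕ} {S : MSt} {d : ℤ} (h : Reach m S) (hd : Rm d S) :
    ∃ m', m = m' + 1 ∧ Reach m' (mv d S) := by
  induction m generalizing S with
  | zero =>
    rw [Reach] at h; subst h
    simp [Rm, vac] at hd; omega
  | succ m ih =>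
    obtain ⟨c, μ, hμ, hc, rfl⟩ := h
    by_cases hdc : d = c
    · subst hdc
      exact ⟨m, rfl, by rwa [mv_mv]⟩
    have hf := rm_rm_far (rm_mv hc) hd hdc
    rw [rm_far hdc hf.1 hf.2] at hd
    obtain ⟨m', rfl, hm'⟩ := ih hμ hd
    refine ⟨m' + 1, rfl, c, mv d μ, hm', ?_, ?_⟩
    · rwa [ad_far (Ne.symm hdc) hf.2 hf.1]
    · rw [mv_comm c d μ hdc hf.1 hf.2]

lemma reach_rm' {m : ℕ} {S : MSt} {d : ℤ} (h : Reach (m+1) S) (hd : Rm d S) : Reach m (mv d S) := by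
  obtain ⟨m', h1, h2⟩ := reach_rm h hd
  have : m = m' := by omega
  subst this; exact h2

lemma reach_bd {m : ℕ} {S : MSt} (h : Reach m S) :
    (∀ x : ℤ, x ≤ -m → S x = true) ∧ ∀ x : ℤ, m < x → S x = false := by
  induction m generalizing S with
  | zero => rw [Reach] at h; subst h; simp [vac]
  | succ m ih =>
    obtain ⟨c, μ, hμ, hc, rfl⟩ := h
    obtain ⟨h1, h2⟩ := ih hμ
    have hc1 : c ≤ m := by by_contra hh; have := hc.1; rw [h2 c (by omega)] at this; simp at this
    have hc2 : -m ≤ c := by by_contra hh; have := hc.2; rw [h1 (c+1) (by omega)] at this; simp at this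
    push_cast
    constructor
    · intro x hx
      rw [mv_ne _ _ _ (by omega) (by omega)]; exact h1 x (by omega)
    · intro x hx
      rw [mv_ne _ _ _ (by omega) (by omega)]; exact h2 x (by omega)

/-- removable contents -/
noncomputable def Rs (n : ℕ) (S : MSt) : Finset ℤ := (Icc (-n : ℤ) n).filter (fun c => Rm c S)
/-- addable contents -/
noncomputable def As (n : ℕ) (S : MSt) : Finset ℤ := (Icc (-n : ℤ) n).filter (fun c => Ad c S)

lemma mem_Rs {n : ℕ} {S : MSt} (h : Reach n S) {c : ℤ} : c ∈ Rs n S ↔ Rm c S := by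
  simp only [Rs, mem_filter, mem_Icc, and_iff_right_iff_imp]
  intro hc
  obtain ⟨h1, h2⟩ := reach_bd h
  constructor
  · by_contra hh; have := hc.1; rw [h1 c (by omega)] at this; simp at this
  · by_contra hh; have := hc.2; rw [h2 (c+1) (by omega)] at this; simp at this

lemma mem_As {n : ℕ} {S : MSt} (h : Reach n S) {c : ℤ} : c ∈ As n S ↔ Ad c S := by
  simp only [As, mem_filter, mem_Icc, and_iff_right_iff_imp]
  intro hc
  obtain ⟨h1, h2⟩ := reach_bd h
  constructor
  · by_contra hh; have := hc.2; rw [h1 (c+1) (by omega)] at this; simp at this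
  · by_contra hh; have := hc.1; rw [h2 c (by omega)] at this; simp at this

lemma card_As {n : ℕ} {S : MSt} (h : Reach n S) : (As n S).card = (Rs n S).card + 1 := by
  obtain ⟨h1, h2⟩ := reach_bd h
  let b : ℤ → ℤ := fun x => if S x then 1 else 0
  have e1 : ((As n S).card : ℤ) - (Rs n S).card = ∑ c ∈ Icc (-n : ℤ) n, (b c - b (c+1)) := by
    rw [As, Rs, Finset.card_filter, Finset.card_filter]
    push_cast
    rw [← Finset.sum_sub_distrib]
    refine Finset.sum_congr rfl fun c _ => ?_
    simp only [b, Ad, Rm]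
    rcases Bool.eq_false_or_eq_true (S c) with h3 | h3 <;> rcases Bool.eq_false_or_eq_true (S (c+1)) with h4 | h4 <;> simp [h3, h4]
  have key : ∀ k : ℕ, ∑ c ∈ Icc (-n : ℤ) (-n + k), (b c - b (c+1)) = b (-n) - b (-n + k + 1) := by
    intro k
    induction k with
    | zero => simp
    | succ k ih =>
      have : Icc (-n : ℤ) (-n + (k+1 : ℕ)) = insert (-n + (k : ℤ) + 1) (Icc (-n : ℤ) (-n + k)) := by
        ext x; simp only [mem_Icc, mem_insert]; push_cast; omega
      rw [this, Finset.sum_insert (by simp only [mem_Icc]; omega), ih]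
      push_cast
      rw [show (-(n:ℤ) + (k + 1) + 1) = -n + k + 1 + 1 by ring]
      ring
  have := key (2 * n)
  rw [show (-(n:ℤ) + (2 * n : ℕ)) = n by push_cast; ring, ← e1] at this
  simp only [b] at this
  rw [h1 (-n) le_rfl, h2 (n+1) (by omega)] at this
  simp at this
  omega

/-- level sets -/
noncomputable def Lv : ℕ → Finset MSt
  | 0 => {vac}
  | m+1 => by classical exact (Lv m).biUnion fun μ => (As m μ).image fun c => mv c μ

lemma mem_Lv {n : ℕ} {S : MSt} : S ∈ Lv n ↔ Reach n S := by
  induction n generalizing S with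
  | zero => simp [Lv, Reach]
  | succ n ih =>
    simp only [Lv, mem_biUnion, mem_image, Reach]
    constructor
    · rintro ⟨μ, hμ, c, hc, rfl⟩
      rw [ih] at hμ
      exact ⟨c, μ, hμ, (mem_As hμ).1 hc, rfl⟩
    · rintro ⟨c, μ, hμ, hc, rfl⟩
      exact ⟨μ, ih.2 hμ, c, (mem_As hμ).2 hc, rfl⟩

/-- number of paths -/
noncomputable def fn : ℕ → MSt → ℕ
  | 0, S => by classical exact if S = vac then 1 else 0
  | m+1, S => ∑ c ∈ Rs (m+1) S, fn m (mv c S)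

lemma exists_rm {n : ℕ} {S : MSt} (h : Reach (n+1) S) : ∃ c, Rm c S := by
  obtain ⟨c, μ, hμ, hc, rfl⟩ := h
  exact ⟨c, rm_mv hc⟩

lemma fn_pos {n : ℕ} {S : MSt} (h : Reach n S) : 1 ≤ fn n S := by
  induction n generalizing S with
  | zero => rw [Reach] at h; simp [fn, h]
  | succ n ih =>
    obtain ⟨c, hc⟩ := exists_rm h
    rw [fn]
    calc 1 ≤ fn n (mv c S) := ih (reach_rm' h hc)
      _ ≤ _ := Finset.single_le_sum (f := fun c => fn n (mv c S)) (fun _ _ => Nat.zero_le _) ((mem_Rs h).2 hc)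

lemma fn_le {n : ℕ} {S : MSt} (h : Reach (n+1) S) {c : ℤ} (hc : Rm c S) : fn n (mv c S) ≤ fn (n+1) S := by
  rw [fn]
  exact Finset.single_le_sum (f := fun c => fn n (mv c S)) (fun _ _ => Nat.zero_le _) ((mem_Rs h).2 hc)

lemma sum_swap {M : Type*} [AddCommMonoid M] (n : ℕ) (F : MSt → MSt → ℤ → M) :
    ∑ l ∈ Lv (n+1), ∑ c ∈ Rs (n+1) l, F l (mv c l) c = ∑ μ ∈ Lv n, ∑ c ∈ As n μ, F (mv c μ) μ c := by
  rw [Finset.sum_sigma', Finset.sum_sigma']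
  refine Finset.sum_bij' (fun x _ => ⟨mv x.2 x.1, x.2⟩) (fun x _ => ⟨mv x.2 x.1, x.2⟩) ?_ ?_ ?_ ?_ ?_
  · rintro ⟨l, c⟩ h
    simp only [mem_sigma, mem_Lv] at h ⊢
    have hc := (mem_Rs h.1).1 h.2
    have hr := reach_rm' h.1 hc
    exact ⟨hr, (mem_As hr).2 (ad_mv hc)⟩
  · rintro ⟨l, c⟩ h
    simp only [mem_sigma, mem_Lv] at h ⊢
    have hc := (mem_As h.1).1 h.2
    have hr : Reach (n+1) (mv c l) := ⟨c, l, h.1, hc, rfl⟩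
    exact ⟨hr, (mem_Rs hr).2 (rm_mv hc)⟩
  · rintro ⟨l, c⟩ h; simp [mv_mv]
  · rintro ⟨l, c⟩ h; simp [mv_mv]
  · rintro ⟨l, c⟩ h; simp [mv_mv]


def rowS (n : ℕ) : MSt := fun x => decide (x ≤ -1 ∨ x = n)
def colS (n : ℕ) : MSt := fun x => decide (x ≤ 1 ∧ x ≠ 1 - n)
def hkr (n : ℕ) : MSt := mv (-1) (rowS n)
def hkc (n : ℕ) : MSt := mv 1 (colS n)

lemma row_zero : rowS 0 = vac := by
  funext x; simp only [rowS, vac, decide_eq_decide]; push_cast; first | omega | grind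
lemma col_zero : colS 0 = vac := by
  funext x; simp only [colS, vac, decide_eq_decide]; push_cast; first | omega | grind
lemma ad_row {d : ℤ} {n : ℕ} (h : Ad d (rowS n)) : d = n ∨ (d = -1 ∧ 1 ≤ n) := by
  simp only [Ad, rowS, decide_eq_true_eq, decide_eq_false_iff_not] at h; first | omega | grind
lemma ad_col {d : ℤ} {n : ℕ} (h : Ad d (colS n)) : d = -n ∨ (d = 1 ∧ 1 ≤ n) := by
  simp only [Ad, colS, decide_eq_true_eq, decide_eq_false_iff_not] at h; first | omega | grind
lemma ad_row' (n : ℕ) : Ad n (rowS n) := by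
  simp only [Ad, rowS, decide_eq_true_eq, decide_eq_false_iff_not]; first | omega | grind
lemma ad_col' (n : ℕ) : Ad (-n) (colS n) := by
  simp only [Ad, colS, decide_eq_true_eq, decide_eq_false_iff_not]; first | omega | grind
lemma ad_row'' {n : ℕ} (h : 1 ≤ n) : Ad (-1) (rowS n) := by
  simp only [Ad, rowS, decide_eq_true_eq, decide_eq_false_iff_not]; first | omega | grind
lemma ad_col'' {n : ℕ} (h : 1 ≤ n) : Ad 1 (colS n) := by
  simp only [Ad, colS, decide_eq_true_eq, decide_eq_false_iff_not]; first | omega | grind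
lemma mv_row (n : ℕ) : mv n (rowS n) = rowS (n+1) := by
  funext x; simp only [mv, rowS]; split_ifs <;> rw [decide_eq_decide] <;> push_cast <;> first | omega | grind
lemma mv_col (n : ℕ) : mv (-n) (colS n) = colS (n+1) := by
  funext x; simp only [mv, colS]; split_ifs <;> rw [decide_eq_decide] <;> push_cast <;> first | omega | grind
lemma reach_row (n : ℕ) : Reach n (rowS n) := by
  induction n with
  | zero => exact row_zero
  | succ n ih => exact ⟨n, rowS n, ih, ad_row' n, (mv_row n).symm⟩
lemma reach_col (n : ℕ) : Reach n (colS n) := by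
  induction n with
  | zero => exact col_zero
  | succ n ih => exact ⟨-n, colS n, ih, ad_col' n, (mv_col n).symm⟩
lemma reach_hkr {n : ℕ} (h : 1 ≤ n) : Reach (n+1) (hkr n) := ⟨-1, _, reach_row n, ad_row'' h, rfl⟩
lemma reach_hkc {n : ℕ} (h : 1 ≤ n) : Reach (n+1) (hkc n) := ⟨1, _, reach_col n, ad_col'' h, rfl⟩

lemma fn_hkr {n : ℕ} (h : 1 ≤ n) : n ≤ fn (n+1) (hkr n) := by
  induction n, h using Nat.le_induction with
  | base => exact fn_pos (reach_hkr le_rfl)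
  | succ n hn ih =>
    have hr := reach_hkr (n := n+1) (by omega)
    have h1 : mv (-1) (hkr (n+1)) = rowS (n+1) := mv_mv _ _
    have h2 : Rm n (hkr (n+1)) := by
      simp only [Rm, hkr, mv, rowS]; push_cast
      constructor <;> (split_ifs <;> first | omega | grind | (simp only [decide_eq_true_eq, decide_eq_false_iff_not]; first | omega | grind))
    have h3 : mv n (hkr (n+1)) = hkr n := by
      funext x; simp only [hkr, mv, rowS]; push_cast
      split_ifs <;> first | omega | grind | (rw [decide_eq_decide]; first | omega | grind)
    have h4 : Rm (-1) (hkr (n+1)) := rm_mv (ad_row'' (by omega))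
    rw [fn]
    calc n + 1 ≤ ∑ c ∈ {(n : ℤ), -1}, fn (n+1) (mv c (hkr (n+1))) := by
          rw [Finset.sum_pair (by omega), h3, h1]
          have := fn_pos (reach_row (n+1)); omega
      _ ≤ _ := Finset.sum_le_sum_of_subset (by
          intro c hc
          rw [mem_Rs hr]
          simp only [mem_insert, mem_singleton] at hc
          rcases hc with rfl | rfl <;> assumption)

lemma fn_hkc {n : ℕ} (h : 1 ≤ n) : n ≤ fn (n+1) (hkc n) := by
  induction n, h using Nat.le_induction with
  | base => exact fn_pos (reach_hkc le_rfl)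
  | succ n hn ih =>
    have hr := reach_hkc (n := n+1) (by omega)
    have h1 : mv 1 (hkc (n+1)) = colS (n+1) := mv_mv _ _
    have h2 : Rm (-n) (hkc (n+1)) := by
      simp only [Rm, hkc, mv, colS]; push_cast
      constructor <;> (split_ifs <;> first | omega | grind | (simp only [decide_eq_true_eq, decide_eq_false_iff_not]; first | omega | grind))
    have h3 : mv (-n) (hkc (n+1)) = hkc n := by
      funext x; simp only [hkc, mv, colS]; push_cast
      split_ifs <;> first | omega | grind | (rw [decide_eq_decide]; first | omega | grind)
    have h4 : Rm 1 (hkc (n+1)) := rm_mv (ad_col'' (by omega))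
    rw [fn]
    calc n + 1 ≤ ∑ c ∈ {(-n : ℤ), 1}, fn (n+1) (mv c (hkc (n+1))) := by
          rw [Finset.sum_pair (by omega), h3, h1]
          have := fn_pos (reach_col (n+1)); omega
      _ ≤ _ := Finset.sum_le_sum_of_subset (by
          intro c hc
          rw [mem_Rs hr]
          simp only [mem_insert, mem_singleton] at hc
          rcases hc with rfl | rfl <;> assumption)

lemma fn_row (n : ℕ) : fn n (rowS n) = 1 := by
  induction n with
  | zero => simp [fn, row_zero]
  | succ n ih =>
    rw [fn]
    have : Rs (n+1) (rowS (n+1)) = {(n : ℤ)} := by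
      ext c
      rw [mem_Rs (reach_row _)]
      simp only [Rm, rowS, decide_eq_true_eq, decide_eq_false_iff_not, mem_singleton]; push_cast; first | omega | grind
    rw [this, sum_singleton, ← mv_row, mv_mv, ih]
lemma fn_col (n : ℕ) : fn n (colS n) = 1 := by
  induction n with
  | zero => simp [fn, col_zero]
  | succ n ih =>
    rw [fn]
    have : Rs (n+1) (colS (n+1)) = {(-n : ℤ)} := by
      ext c
      rw [mem_Rs (reach_col _)]
      simp only [Rm, colS, decide_eq_true_eq, decide_eq_false_iff_not, mem_singleton]; push_cast; first | omega | grind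
    rw [this, sum_singleton, ← mv_col, mv_mv, ih]

lemma above_lin {n : ℕ} {l : MSt} {c : ℤ} (hc : Rm c l)
    (hm : mv c l = rowS n ∨ mv c l = colS n) :
    l = rowS (n+1) ∨ l = colS (n+1) ∨ (1 ≤ n ∧ (l = hkr n ∨ l = hkc n)) := by
  have ha := ad_mv hc
  rcases hm with hm | hm
  · have hl : l = mv c (rowS n) := by rw [← hm, mv_mv]
    rw [hm] at ha
    rcases ad_row ha with rfl | ⟨rfl, h⟩
    · left; rw [hl, mv_row]
    · right; right; exact ⟨h, Or.inl hl⟩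
  · have hl : l = mv c (colS n) := by rw [← hm, mv_mv]
    rw [hm] at ha
    rcases ad_col ha with rfl | ⟨rfl, h⟩
    · right; left; rw [hl, mv_col]
    · right; right; exact ⟨h, Or.inr hl⟩

lemma fn_one {n : ℕ} {S : MSt} (h : Reach n S) (h1 : fn n S = 1) : S = rowS n ∨ S = colS n := by
  induction n generalizing S with
  | zero => left; rw [row_zero]; exact h
  | succ n ih =>
    obtain ⟨c, hc⟩ := exists_rm h
    have hr := reach_rm' h hc
    have h2 : fn n (mv c S) = 1 := le_antisymm (h1 ▸ fn_le h hc) (fn_pos hr)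
    rcases above_lin hc (ih hr h2) with h | h | ⟨hn, h⟩
    · exact Or.inl h
    · exact Or.inr h
    · have h3 : n = 1 := by
        rcases h with rfl | rfl
        · have := fn_hkr hn; omega
        · have := fn_hkc hn; omega
      subst h3
      rcases h with rfl | rfl
      · right; funext x; simp only [hkr, mv, rowS, colS]; push_cast
        split_ifs <;> first | omega | grind | (rw [decide_eq_decide]; first | omega | grind)
      · left; funext x; simp only [hkc, mv, rowS, colS]; push_cast
        split_ifs <;> first | omega | grind | (rw [decide_eq_decide]; first | omega | grind)

lemma below_lin {n : ℕ} {l : MSt} (h : Reach (n+1) l) {c : ℤ} (hc : Rm c l)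
    (h1 : ¬ 2 ≤ fn n (mv c l)) (h2 : 2 ≤ fn (n+1) l) : (l = hkr n ∨ l = hkc n) ∧ n ≤ fn (n+1) l := by
  have hr := reach_rm' h hc
  have := fn_pos hr
  rcases above_lin hc (fn_one hr (by omega)) with h | h | ⟨hn, h⟩
  · rw [h, fn_row] at h2; omega
  · rw [h, fn_col] at h2; omega
  · refine ⟨h, ?_⟩
    rcases h with rfl | rfl
    · exact fn_hkr hn
    · exact fn_hkc hn

lemma rect_left {n : ℕ} {S : MSt} {d : ℤ} (h : Reach n S) (hR : ∀ c, Rm c S → c = d) (hd : S (d-1) = true) :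
    fn n S = 1 := by
  induction n generalizing S d with
  | zero => rw [Reach] at h; simp [fn, h]
  | succ n ih =>
    obtain ⟨c, hc⟩ := exists_rm h
    obtain rfl := hR c hc
    have hr := reach_rm' h hc
    have : Rs (n+1) S = {c} := by
      ext x; rw [mem_Rs h, mem_singleton]; exact ⟨hR x, fun h => h ▸ hc⟩
    rw [fn, this, sum_singleton]
    refine ih (d := c+1) hr ?_ ?_
    · intro x hx
      by_contra hne
      by_cases h1 : x = c
      · subst h1; have := hx.1; rw [mv_self, hc.2] at this; simp at this
      by_cases h2 : c = x + 1
      · subst h2; have := hx.1; rw [mv_ne _ _ _ (by omega) (by omega)] at this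
        rw [add_sub_cancel_right] at hd; rw [hd] at this; simp at this
      rw [rm_far h1 hne h2] at hx
      exact h1 (hR x hx)
    · rw [add_sub_cancel_right, mv_self, hc.2]

lemma rect_right {n : ℕ} {S : MSt} {d : ℤ} (h : Reach n S) (hR : ∀ c, Rm c S → c = d) (hd : S (d+2) = false) :
    fn n S = 1 := by
  induction n generalizing S d with
  | zero => rw [Reach] at h; simp [fn, h]
  | succ n ih =>
    obtain ⟨c, hc⟩ := exists_rm h
    obtain rfl := hR c hc
    have hr := reach_rm' h hc
    have : Rs (n+1) S = {c} := by
      ext x; rw [mem_Rs h, mem_singleton]; exact ⟨hR x, fun h => h ▸ hc⟩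
    rw [fn, this, sum_singleton]
    refine ih (d := c-1) hr ?_ ?_
    · intro x hx
      by_contra hne
      by_cases h1 : x = c
      · subst h1; have := hx.1; rw [mv_self, hc.2] at this; simp at this
      by_cases h2 : x = c + 1
      · subst h2; have := hx.2; rw [mv_ne _ _ _ (by omega) (by omega)] at this
        rw [show c + 1 + 1 = c + 2 by ring, hd] at this; simp at this
      rw [rm_far h1 h2 (by omega)] at hx
      exact h1 (hR x hx)
    · rw [show c - 1 + 2 = c + 1 by ring, mv_succ, hc.1]

lemma jensen_sq {ι : Type*} (s : Finset ι) (x : ι → ℝ) (hs : 0 < s.card) (hx : ∀ i ∈ s, 0 < x i) :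
    1 / (∑ i ∈ s, x i) ^ 2 ≤ (1 / (s.card : ℝ) ^ 3) * ∑ i ∈ s, 1 / (x i) ^ 2 := by
  set X := ∑ i ∈ s, x i with hX
  have hr : (0 : ℝ) < s.card := by exact_mod_cast hs
  have hXp : 0 < X := Finset.sum_pos hx (Finset.card_pos.1 hs)
  set a := X / s.card with ha
  have hap : 0 < a := by positivity
  have h1 : ∑ i ∈ s, (3 / a ^ 2 - 2 * x i / a ^ 3) ≤ ∑ i ∈ s, 1 / (x i) ^ 2 := by
    refine Finset.sum_le_sum fun i hi => ?_
    have hxi := hx i hi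
    have : 1 / (x i) ^ 2 - (3 / a ^ 2 - 2 * x i / a ^ 3) = (a - x i) ^ 2 * (a + 2 * x i) / (x i ^ 2 * a ^ 3) := by
      field_simp; ring
    have h2 : 0 ≤ (a - x i) ^ 2 * (a + 2 * x i) / (x i ^ 2 * a ^ 3) := by positivity
    linarith
  have h2 : ∑ i ∈ s, (3 / a ^ 2 - 2 * x i / a ^ 3) = (s.card : ℝ) ^ 3 / X ^ 2 := by
    have e : ∑ i ∈ s, 2 * x i / a ^ 3 = 2 * X / a ^ 3 := by
      rw [← Finset.sum_div, ← Finset.mul_sum]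
    rw [Finset.sum_sub_distrib, e, Finset.sum_const, nsmul_eq_mul, ha]
    field_simp; ring
  rw [h2] at h1
  calc 1 / X ^ 2 = (1 / (s.card : ℝ) ^ 3) * ((s.card : ℝ) ^ 3 / X ^ 2) := by field_simp
    _ ≤ _ := by gcongr

noncomputable def qn (n : ℕ) (S : MSt) : ℝ := if 2 ≤ fn n S then 1 / (fn n S : ℝ) ^ 2 else 0

lemma qn_nonneg (n : ℕ) (S : MSt) : 0 ≤ qn n S := by unfold qn; split_ifs <;> positivity

def Sp (n : ℕ) (S : MSt) : Prop := ∃ c, Rs n S = {c-1, c+1}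
def Rect (n : ℕ) (l : MSt) (c : ℤ) : Prop := Rs n l = {c} ∧ l (c-1) = false ∧ l (c+2) = true

open Classical in
noncomputable def hk (n : ℕ) (l : MSt) : ℝ := if l = hkr n ∨ l = hkc n then 1 / (n : ℝ) ^ 2 else 0
lemma hk_nonneg (n : ℕ) (S : MSt) : 0 ≤ hk n S := by unfold hk; split_ifs <;> positivity

lemma qn_hook {n : ℕ} (hn : 1 ≤ n) {l : MSt} (h : Reach (n+1) l) {c : ℤ} (hc : Rm c l)
    (h1 : ¬ 2 ≤ fn n (mv c l)) : qn (n+1) l ≤ hk n l := by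
  by_cases h2 : 2 ≤ fn (n+1) l
  · obtain ⟨h3, h4⟩ := below_lin h hc h1 h2
    rw [hk, if_pos h3, qn, if_pos h2]
    have : (0:ℝ) < n := by exact_mod_cast hn
    have : (n:ℝ) ≤ fn (n+1) l := by exact_mod_cast h4
    gcongr
  · rw [qn, if_neg h2]; exact hk_nonneg _ _

lemma qn_jensen {n : ℕ} (hn : 1 ≤ n) {l : MSt} (h : Reach (n+1) l) :
    qn (n+1) l ≤ hk n l + (1 / ((Rs (n+1) l).card : ℝ) ^ 3) * ∑ c ∈ Rs (n+1) l, qn n (mv c l) := by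
  have hs : 0 ≤ (1 / ((Rs (n+1) l).card : ℝ) ^ 3) * ∑ c ∈ Rs (n+1) l, qn n (mv c l) := by
    have := Finset.sum_nonneg (s := Rs (n+1) l) fun c _ => qn_nonneg n (mv c l)
    positivity
  by_cases h1 : ∀ c ∈ Rs (n+1) l, 2 ≤ fn n (mv c l)
  · have h2 := hk_nonneg n l
    refine le_trans ?_ (le_add_of_nonneg_left h2)
    by_cases h3 : 2 ≤ fn (n+1) l
    · have hcp : 0 < (Rs (n+1) l).card := by
        obtain ⟨c, hc⟩ := exists_rm h
        exact Finset.card_pos.2 ⟨c, (mem_Rs h).2 hc⟩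
      have hj := jensen_sq (Rs (n+1) l) (fun c => (fn n (mv c l) : ℝ)) hcp (fun c hc => by
        have := h1 c hc
        have : 0 < fn n (mv c l) := by omega
        exact_mod_cast this)
      rw [qn, if_pos h3, fn]
      push_cast
      refine hj.trans (le_of_eq ?_)
      congr 1
      refine Finset.sum_congr rfl fun c hc => ?_
      rw [qn, if_pos (h1 c hc)]
    · rw [qn, if_neg h3]; exact hs
  · push Not at h1
    obtain ⟨c, hc, h1⟩ := h1
    exact (qn_hook hn h ((mem_Rs h).1 hc) (by omega)).trans (le_add_of_nonneg_right hs)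

open Classical in
lemma qn_split {n : ℕ} (hn : 1 ≤ n) {l : MSt} (h : Reach (n+1) l) :
    qn (n+1) l ≤ hk n l + ∑ c ∈ Rs (n+1) l, (if 2 ≤ (Rs (n+1) l).card then
      (1 / ((Rs (n+1) l).card : ℝ) ^ 3) * qn n (mv c l) else 0)
      + ∑ c ∈ Rs (n+1) l, (if Rect (n+1) l c then qn n (mv c l) else 0) := by
  have hB : 0 ≤ ∑ c ∈ Rs (n+1) l, (if Rect (n+1) l c then qn n (mv c l) else 0) :=
    Finset.sum_nonneg fun c _ => by
      have := qn_nonneg n (mv c l)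
      split_ifs <;> simp [this]
  by_cases h1 : 2 ≤ (Rs (n+1) l).card
  · have := qn_jensen hn h
    simp only [h1, if_true]
    rw [← Finset.mul_sum]
    linarith
  · simp only [h1, if_false, Finset.sum_const_zero, add_zero]
    obtain ⟨c, hc⟩ := exists_rm h
    have hR : Rs (n+1) l = {c} := by
      symm; apply Finset.eq_of_subset_of_card_le
      · simpa using (mem_Rs h).2 hc
      · simp; omega
    by_cases h2 : 2 ≤ fn (n+1) l
    · have hRc : ∀ x, Rm x l → x = c := by
        intro x hx
        have := (mem_Rs h).2 hx
        rw [hR] at this; simpa using this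
      have h3 : l (c-1) = false := by
        by_contra hh
        have := rect_left h hRc (by simpa using hh); omega
      have h4 : l (c+2) = true := by
        by_contra hh
        have := rect_right h hRc (by simpa using hh); omega
      have hk0 := hk_nonneg n l
      have hRect : Rect (n+1) l c := ⟨hR, h3, h4⟩
      rw [hR, sum_singleton, if_pos hRect]
      have : qn (n+1) l = qn n (mv c l) := by
        rw [qn, qn, fn, hR, sum_singleton]
      linarith
    · rw [qn, if_neg h2]
      have := hk_nonneg n l
      linarith

noncomputable def En (n : ℕ) : ℝ := ∑ S ∈ Lv n, qn n S
open Classical in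
noncomputable def Tn (n : ℕ) : ℝ := ∑ S ∈ Lv n, if Sp n S then qn n S else 0

lemma sum_hk (n : ℕ) : ∑ l ∈ Lv (n+1), hk n l ≤ 2 / (n : ℝ) ^ 2 := by
  classical
  unfold hk
  rw [← Finset.sum_filter, Finset.sum_const, nsmul_eq_mul]
  have : ((Lv (n+1)).filter (fun l => l = hkr n ∨ l = hkc n)).card ≤ 2 := by
    refine (Finset.card_le_card (t := {hkr n, hkc n}) ?_).trans Finset.card_le_two
    intro l hl
    simp only [mem_filter] at hl
    simpa using hl.2
  have h2 : (((Lv (n+1)).filter (fun l => l = hkr n ∨ l = hkc n)).card : ℝ) ≤ 2 := by exact_mod_cast this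
  calc _ ≤ 2 * (1 / (n:ℝ) ^ 2) := by gcongr
    _ = _ := by ring

lemma rs_mv {n : ℕ} {μ : MSt} (h : Reach n μ) {c : ℤ} (hc : Ad c μ) :
    (Rs n μ).card ≤ (Rs (n+1) (mv c μ)).card + 1 := by
  have hr : Reach (n+1) (mv c μ) := ⟨c, μ, h, hc, rfl⟩
  have h1 : Rs n μ ⊆ insert (c-1) (insert (c+1) ((Rs (n+1) (mv c μ)).erase c)) := by
    intro x hx
    rw [mem_Rs h] at hx
    simp only [mem_insert, mem_erase, mem_Rs hr]
    by_cases h1 : x = c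
    · subst h1; have := hx.1; rw [hc.1] at this; simp at this
    by_cases h2 : x = c + 1
    · exact Or.inr (Or.inl h2)
    by_cases h3 : c = x + 1
    · left; omega
    right; right; exact ⟨h1, (rm_far h1 h2 h3).2 hx⟩
  have h2 := Finset.card_le_card h1
  have h3 : c ∈ Rs (n+1) (mv c μ) := (mem_Rs hr).2 (rm_mv hc)
  have h4 := Finset.card_erase_add_one h3
  have h5 := Finset.card_insert_le (c-1) (insert (c+1) ((Rs (n+1) (mv c μ)).erase c))
  have h6 := Finset.card_insert_le (c+1) ((Rs (n+1) (mv c μ)).erase c)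
  omega

lemma num_bd (r s : ℕ) (hs : 2 ≤ s) (h : r ≤ s + 1) :
    1 / (s : ℝ) ^ 3 ≤ 1 / (2 * ((r : ℝ) + 1)) := by
  have h1 : 2 * (r + 1) ≤ s ^ 3 := by
    have : 2 * (s + 2) ≤ s ^ 3 := by nlinarith [mul_le_mul hs hs (by omega) (by omega)]
    omega
  have h2 : 2 * ((r:ℝ) + 1) ≤ (s:ℝ) ^ 3 := by exact_mod_cast h1
  gcongr

lemma Rect_rs {n : ℕ} {μ : MSt} (h : Reach n μ) {c : ℤ} (hc : Ad c μ) (hR : Rect (n+1) (mv c μ) c) :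
    Rs n μ = {c-1, c+1} := by
  have hr : Reach (n+1) (mv c μ) := ⟨c, μ, h, hc, rfl⟩
  obtain ⟨h1, h2, h3⟩ := hR
  rw [mv_ne _ _ _ (by omega) (by omega)] at h2 h3
  ext x
  rw [mem_Rs h]
  simp only [mem_insert, mem_singleton]
  constructor
  · intro hx
    by_contra hne
    push Not at hne
    by_cases hxc : x = c
    · subst hxc; have := hx.1; rw [hc.1] at this; simp at this
    have := (rm_far hxc hne.2 (by omega)).2 hx
    rw [← mem_Rs hr, h1] at this
    simp at this; exact hxc this
  · rintro (rfl | rfl)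
    · exact ⟨h2, by rw [sub_add_cancel]; exact hc.1⟩
    · exact ⟨hc.2, by rw [add_assoc]; exact h3⟩

lemma En_rec {n : ℕ} (hn : 1 ≤ n) : En (n+1) ≤ 2 / (n:ℝ)^2 + 1/2 * En n + Tn n := by
  classical
  have h1 : En (n+1) ≤ ∑ l ∈ Lv (n+1), (hk n l + ∑ c ∈ Rs (n+1) l, (if 2 ≤ (Rs (n+1) l).card then
      (1 / ((Rs (n+1) l).card : ℝ) ^ 3) * qn n (mv c l) else 0)
      + ∑ c ∈ Rs (n+1) l, (if Rect (n+1) l c then qn n (mv c l) else 0)) :=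
    Finset.sum_le_sum fun l hl => qn_split hn (mem_Lv.1 hl)
  rw [Finset.sum_add_distrib, Finset.sum_add_distrib] at h1
  rw [sum_swap n (fun l μ _ => if 2 ≤ (Rs (n+1) l).card then
      (1 / ((Rs (n+1) l).card : ℝ) ^ 3) * qn n μ else 0),
    sum_swap n (fun l μ c => if Rect (n+1) l c then qn n μ else 0)] at h1
  have h2 := sum_hk n
  have h3 : ∑ μ ∈ Lv n, ∑ c ∈ As n μ, (if 2 ≤ (Rs (n+1) (mv c μ)).card then
      (1 / ((Rs (n+1) (mv c μ)).card : ℝ) ^ 3) * qn n μ else 0) ≤ 1/2 * En n := by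
    rw [En, Finset.mul_sum]
    refine Finset.sum_le_sum fun μ hμ => ?_
    have hr := mem_Lv.1 hμ
    have hq := qn_nonneg n μ
    calc _ ≤ ∑ c ∈ As n μ, 1 / (2 * (((Rs n μ).card : ℝ) + 1)) * qn n μ := by
          refine Finset.sum_le_sum fun c hc => ?_
          have hc' := (mem_As hr).1 hc
          split_ifs with h2
          · exact mul_le_mul_of_nonneg_right (num_bd _ _ h2 (rs_mv hr hc')) hq
          · positivity
      _ = 1/2 * qn n μ := by
          rw [Finset.sum_const, card_As hr, nsmul_eq_mul]
          push_cast
          field_simp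
  have h4 : ∑ μ ∈ Lv n, ∑ c ∈ As n μ, (if Rect (n+1) (mv c μ) c then qn n μ else 0) ≤ Tn n := by
    rw [Tn]
    refine Finset.sum_le_sum fun μ hμ => ?_
    have hr := mem_Lv.1 hμ
    have hq := qn_nonneg n μ
    rw [← Finset.sum_filter, Finset.sum_const, nsmul_eq_mul]
    have hle : ((As n μ).filter (fun c => Rect (n+1) (mv c μ) c)).card ≤ 1 := by
      rw [Finset.card_le_one]
      intro a ha b hb
      simp only [mem_filter, mem_As hr] at ha hb
      have e1 := Rect_rs hr ha.1 ha.2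
      have e2 := Rect_rs hr hb.1 hb.2
      rw [e1] at e2
      have m1 : a - 1 ∈ ({b-1, b+1} : Finset ℤ) := by rw [← e2]; simp
      have m2 : a + 1 ∈ ({b-1, b+1} : Finset ℤ) := by rw [← e2]; simp
      simp only [mem_insert, mem_singleton] at m1 m2
      omega
    have hle' : (((As n μ).filter (fun c => Rect (n+1) (mv c μ) c)).card : ℝ) ≤ 1 := by exact_mod_cast hle
    split_ifs with hsp
    · calc _ ≤ 1 * qn n μ := by gcongr
        _ = _ := one_mul _
    · have : ((As n μ).filter (fun c => Rect (n+1) (mv c μ) c)) = ∅ := by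
        rw [Finset.filter_eq_empty_iff]
        intro c hc hR
        exact hsp ⟨c, Rect_rs hr ((mem_As hr).1 hc) hR⟩
      rw [this]; simp
  linarith

lemma sp_below {n : ℕ} {μ : MSt} (h : Reach n μ) {e : ℤ} (he : Ad e μ) (hs : Sp (n+1) (mv e μ)) :
    (Rs n μ).card ≤ 2 := by
  have hr : Reach (n+1) (mv e μ) := ⟨e, μ, h, he, rfl⟩
  obtain ⟨c, hc⟩ := hs
  have m0 : ∀ x, Rm x (mv e μ) ↔ x = c - 1 ∨ x = c + 1 := by
    intro x; rw [← mem_Rs hr, hc]; simp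
  have m1 := (m0 e).1 (rm_mv he)
  have key : ∀ x, Rm x μ → x ≠ e ∧ (x = e + 1 ∨ x = e - 1 ∨ x = c - 1 ∨ x = c + 1) := by
    intro x hx
    have hxe : x ≠ e := by
      rintro rfl; have := hx.1; rw [he.1] at this; simp at this
    refine ⟨hxe, ?_⟩
    by_contra hne
    push Not at hne
    have := (m0 x).1 ((rm_far hxe hne.1 (by omega)).2 hx)
    omega
  have hmid : ¬ Rm c μ := by
    intro hx
    rcases m1 with rfl | rfl
    · have h5 := ((m0 (c+1)).2 (Or.inr rfl)).1
      rw [mv_ne _ _ _ (by omega) (by omega)] at h5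
      have := hx.2; rw [h5] at this; simp at this
    · have h5 := ((m0 (c-1)).2 (Or.inl rfl)).2
      rw [sub_add_cancel, mv_ne _ _ _ (by omega) (by omega)] at h5
      have := hx.1; rw [h5] at this; simp at this
  rcases m1 with rfl | rfl
  · refine (Finset.card_le_card (t := {c-2, c+1}) ?_).trans Finset.card_le_two
    intro x hx
    rw [mem_Rs h] at hx
    have h1 := key x hx
    have h2 : x ≠ c := fun h => hmid (h ▸ hx)
    simp only [mem_insert, mem_singleton]; omega
  · refine (Finset.card_le_card (t := {c+2, c-1}) ?_).trans Finset.card_le_two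
    intro x hx
    rw [mem_Rs h] at hx
    have h1 := key x hx
    have h2 : x ≠ c := fun h => hmid (h ▸ hx)
    simp only [mem_insert, mem_singleton]; omega

lemma Tn_rec {n : ℕ} (hn : 1 ≤ n) : Tn (n+1) ≤ 2 / (n:ℝ)^2 + 3/8 * En n := by
  classical
  have h1 : Tn (n+1) ≤ ∑ l ∈ Lv (n+1), (hk n l + ∑ c ∈ Rs (n+1) l, 
      (if Sp (n+1) l then 1/8 * qn n (mv c l) else 0)) := by
    refine Finset.sum_le_sum fun l hl => ?_
    have hr := mem_Lv.1 hl
    split_ifs with hs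
    · have := qn_jensen hn hr
      obtain ⟨c, hc⟩ := hs
      have hcard : (Rs (n+1) l).card = 2 := by rw [hc, Finset.card_pair (by omega)]
      rw [hcard] at this
      rw [← Finset.mul_sum]
      norm_num at this ⊢
      exact this
    · have := hk_nonneg n l
      simpa using this
  rw [Finset.sum_add_distrib, sum_swap n (fun l μ _ => if Sp (n+1) l then 1/8 * qn n μ else 0)] at h1
  have h2 := sum_hk n
  have h3 : ∑ μ ∈ Lv n, ∑ c ∈ As n μ, (if Sp (n+1) (mv c μ) then 1/8 * qn n μ else 0) ≤ 3/8 * En n := by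
    rw [En, Finset.mul_sum]
    refine Finset.sum_le_sum fun μ hμ => ?_
    have hr := mem_Lv.1 hμ
    have hq := qn_nonneg n μ
    by_cases hex : ∃ c ∈ As n μ, Sp (n+1) (mv c μ)
    · obtain ⟨e, he, hs⟩ := hex
      have hcard : (As n μ).card ≤ 3 := by
        rw [card_As hr]
        have := sp_below hr ((mem_As hr).1 he) hs
        omega
      have hcard' : ((As n μ).card : ℝ) ≤ 3 := by exact_mod_cast hcard
      calc _ ≤ ∑ c ∈ As n μ, 1/8 * qn n μ := by
            refine Finset.sum_le_sum fun c hc => ?_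
            split_ifs
            · exact le_rfl
            · positivity
        _ = (As n μ).card * (1/8 * qn n μ) := by rw [Finset.sum_const, nsmul_eq_mul]
        _ ≤ 3 * (1/8 * qn n μ) := by gcongr
        _ = _ := by ring
    · push Not at hex
      rw [Finset.sum_eq_zero]
      · positivity
      · intro c hc; rw [if_neg (hex c hc)]
  linarith

theorem En_bound : ∃ K : ℝ, 0 < K ∧ ∀ n : ℕ, 1 ≤ n → En n ≤ K / (n:ℝ)^2 := by
  have hE : ∀ n, 0 ≤ En n := fun n => Finset.sum_nonneg fun S _ => qn_nonneg n S
  have hrec : ∀ n : ℕ, 1 ≤ n → En (n+2) ≤ 4 / (n:ℝ)^2 + 1/2 * En (n+1) + 3/8 * En n := by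
    intro n hn
    have h1 := En_rec (n := n+1) (by omega)
    have h2 := Tn_rec hn
    have hn' : (0:ℝ) < n := by exact_mod_cast hn
    have h3 : 2 / ((n+1 : ℕ):ℝ)^2 ≤ 2 / (n:ℝ)^2 := by
      gcongr; omega
    have h4 : 4 / (n:ℝ)^2 = 2 / (n:ℝ)^2 + 2 / (n:ℝ)^2 := by ring
    linarith
  let K : ℝ := 200 + ∑ j ∈ range 50, (j:ℝ)^2 * En j
  have hK : 200 ≤ K := by
    have : 0 ≤ ∑ j ∈ range 50, (j:ℝ)^2 * En j := Finset.sum_nonneg fun j _ => mul_nonneg (by positivity) (hE j)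
    simp only [K]; linarith
  refine ⟨K, by linarith, ?_⟩
  intro n
  induction n using Nat.strong_induction_on with
  | _ n ih =>
    intro hn
    have hn' : (0:ℝ) < n := by exact_mod_cast hn
    by_cases hsm : n < 50
    · rw [le_div_iff₀ (by positivity)]
      have := Finset.single_le_sum (f := fun j : ℕ => (j:ℝ)^2 * En j) (s := range 50)
        (fun j _ => mul_nonneg (by positivity) (hE j)) (mem_range.2 hsm)
      simp only [K]; linarith
    · obtain ⟨p, rfl⟩ : ∃ p, n = p + 2 := ⟨n - 2, by omega⟩
      have h1 := hrec p (by omega)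
      have h2 := ih (p+1) (by omega) (by omega)
      have h3 := ih p (by omega) (by omega)
      have hp : (40:ℝ) ≤ p := by
        have : 40 ≤ p := by omega
        exact_mod_cast this
      have hp0 : (0:ℝ) < p := by linarith
      have h4 : K / ((p+1 : ℕ):ℝ)^2 ≤ K / (p:ℝ)^2 := by
        gcongr; omega
      have h5 : En (p+2) ≤ (4 + 7/8 * K) / (p:ℝ)^2 := by
        have : (4 + 7/8 * K) / (p:ℝ)^2 = 4 / (p:ℝ)^2 + 1/2 * (K / (p:ℝ)^2) + 3/8 * (K / (p:ℝ)^2) := by ring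
        rw [this]; linarith
      refine h5.trans ?_
      rw [div_le_div_iff₀ (by positivity) (by positivity)]
      push_cast
      have h6 : 4 + 7/8 * K ≤ 9/10 * K := by linarith
      have h7 : 9/10 * ((p:ℝ)+2)^2 ≤ (p:ℝ)^2 := by nlinarith
      calc (4 + 7/8*K) * ((p:ℝ)+2)^2 ≤ (9/10*K) * ((p:ℝ)+2)^2 := by gcongr
        _ = K * (9/10 * ((p:ℝ)+2)^2) := by ring
        _ ≤ K * (p:ℝ)^2 := by gcongr


def sta (α : ℕ → ℤ) : ℕ → MSt
  | 0 => vac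
  | m+1 => mv (α m) (sta α m)

def IsPath (α : ℕ → ℤ) (m : ℕ) : Prop := ∀ k < m, Ad (α k) (sta α k)

lemma sta_congr {α β : ℕ → ℤ} {m : ℕ} (h : ∀ k < m, α k = β k) : sta α m = sta β m := by
  induction m with
  | zero => rfl
  | succ m ih => rw [sta, sta, h m (by omega), ih fun k hk => h k (by omega)]

lemma IsPath.congr {α β : ℕ → ℤ} {m : ℕ} (h : ∀ k < m, α k = β k) (hp : IsPath α m) : IsPath β m := by
  intro k hk
  rw [← h k hk, ← sta_congr (α := α) (β := β) fun j hj => h j (by omega)]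
  exact hp k hk

lemma IsPath.mono {α : ℕ → ℤ} {m p : ℕ} (hp : IsPath α m) (h : p ≤ m) : IsPath α p :=
  fun k hk => hp k (by omega)

lemma IsPath.reach {α : ℕ → ℤ} {m : ℕ} (hp : IsPath α m) : Reach m (sta α m) := by
  induction m with
  | zero => rfl
  | succ m ih => exact ⟨α m, _, ih (hp.mono (by omega)), hp m (by omega), rfl⟩

/-- extend a path by one step -/
def snocP (α : ℕ → ℤ) (m : ℕ) (c : ℤ) : ℕ → ℤ := fun k => if k < m then α k else if k = m then c else 0

lemma snocP_lt {α : ℕ → ℤ} {m : ℕ} {c : ℤ} {k : ℕ} (h : k < m) : snocP α m c k = α k := by simp [snocP, h]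
lemma snocP_self {α : ℕ → ℤ} {m : ℕ} {c : ℤ} : snocP α m c m = c := by simp [snocP]
lemma snocP_gt {α : ℕ → ℤ} {m : ℕ} {c : ℤ} {k : ℕ} (h : m < k) : snocP α m c k = 0 := by
  simp [snocP, show ¬ k < m by omega, show ¬ k = m by omega]

lemma sta_snocP {α : ℕ → ℤ} {m : ℕ} {c : ℤ} : sta (snocP α m c) m = sta α m :=
  sta_congr fun k hk => snocP_lt hk
lemma sta_snocP' {α : ℕ → ℤ} {m : ℕ} {c : ℤ} : sta (snocP α m c) (m+1) = mv c (sta α m) := by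
  rw [sta, snocP_self, sta_snocP]

lemma IsPath.snocP {α : ℕ → ℤ} {m : ℕ} {c : ℤ} (hp : IsPath α m) (hc : Ad c (sta α m)) :
    IsPath (snocP α m c) (m+1) := by
  intro k hk
  by_cases h : k < m
  · rw [snocP_lt h, sta_congr (β := α) fun j hj => snocP_lt (by omega)]
    exact hp k h
  · obtain rfl : k = m := by omega
    rw [snocP_self, sta_snocP]; exact hc

lemma Reach.path {m : ℕ} {S : MSt} (h : Reach m S) : ∃ α, IsPath α m ∧ sta α m = S := by
  induction m generalizing S with
  | zero => exact ⟨fun _ => 0, fun k hk => by omega, h.symm⟩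
  | succ m ih =>
    obtain ⟨c, μ, hμ, hc, rfl⟩ := h
    obtain ⟨α, h1, rfl⟩ := ih hμ
    exact ⟨snocP α m c, h1.snocP hc, sta_snocP'⟩

lemma conn (m : ℕ) : ∀ (Q : (ℕ → ℤ) → Prop)
    (_ : ∀ α β, (∀ k < m, α k = β k) → Q α → Q β)
    (_ : ∀ α i, i + 1 < m → α i ≠ α (i+1) → α i ≠ α (i+1) + 1 → α (i+1) ≠ α i + 1 →
      Q α → Q (α ∘ Equiv.swap i (i+1)))
    (α β : ℕ → ℤ) (_ : IsPath α m) (_ : IsPath β m) (_ : sta α m = sta β m), Q α → Q β := by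
  induction m with
  | zero => intro Q hc _ α β _ _ _ h; exact hc α β (fun k hk => by omega) h
  | succ m ih =>
    intro Q hcg hsw
    have step : ∀ α β : ℕ → ℤ, IsPath α (m+1) → IsPath β (m+1) → sta α (m+1) = sta β (m+1) →
        α m = β m → Q α → Q β := by
      intro α β ha hb hst hm hQ
      have := ih (fun γ => Q (snocP γ m (α m))) (by
          intro γ δ h
          apply hcg
          intro k hk
          by_cases h1 : k < m
          · rw [snocP_lt h1, snocP_lt h1, h k h1]
          · obtain rfl : k = m := by omega
            rw [snocP_self, snocP_self]) (by
          intro γ i hi h1 h2 h3 hQ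
          have e1 : snocP γ m (α m) i = γ i := snocP_lt (by omega)
          have e2 : snocP γ m (α m) (i+1) = γ (i+1) := snocP_lt (by omega)
          have := hsw _ i (by omega) (by rwa [e1, e2]) (by rwa [e1, e2]) (by rwa [e1, e2]) hQ
          refine hcg _ _ ?_ this
          intro k hk
          by_cases hk1 : k < m
          · rw [snocP_lt hk1]
            simp only [Function.comp]
            rw [snocP_lt]
            rw [Equiv.swap_apply_def]; split_ifs <;> omega
          · obtain rfl : k = m := by omega
            simp only [Function.comp]
            rw [Equiv.swap_apply_of_ne_of_ne (by omega) (by omega), snocP_self, snocP_self]) α β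
        (ha.mono (by omega)) (hb.mono (by omega)) (by
          rw [sta, sta, hm] at hst
          have := congrArg (mv (β m)) hst
          rwa [mv_mv, mv_mv] at this) (by
          refine hcg _ _ ?_ hQ
          intro k hk
          by_cases h1 : k < m
          · rw [snocP_lt h1]
          · obtain rfl : k = m := by omega
            rw [snocP_self])
      refine hcg _ _ ?_ this
      intro k hk
      by_cases h1 : k < m
      · rw [snocP_lt h1]
      · obtain rfl : k = m := by omega
        rw [snocP_self, hm]
    intro α β ha hb hst hQ
    by_cases hm : α m = β m
    · exact step α β ha hb hst hm hQ
    set c := α m with hc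
    set d := β m with hd
    set S := sta α (m+1) with hS
    have hRc : Rm c S := rm_mv (ha m (by omega))
    have hRd : Rm d S := by rw [hst]; exact rm_mv (hb m (by omega))
    obtain ⟨f1, f2⟩ := rm_rm_far hRc hRd (Ne.symm hm)
    have hr1 := reach_rm' ha.reach hRc
    have hr2 := reach_rm' ha.reach hRd
    have hRd' : Rm d (mv c S) := (rm_far (Ne.symm hm) f1 f2).2 hRd
    have hRc' : Rm c (mv d S) := (rm_far hm f2 f1).2 hRc
    obtain ⟨p, hp, hν⟩ := reach_rm hr1 hRd'
    subst hp
    obtain ⟨γ, g1, g2⟩ := hν.path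
    have g3 : sta γ p = mv c (mv d S) := by rw [g2, mv_comm c d S (Ne.symm hm) f1 f2]
    have p1 : IsPath (snocP γ p d) (p+1) := g1.snocP (by rw [g2]; exact ad_mv hRd')
    have s1 : sta (snocP γ p d) (p+1) = mv c S := by rw [sta_snocP', g2, mv_mv]
    have p2 : IsPath (snocP γ p c) (p+1) := g1.snocP (by rw [g3]; exact ad_mv hRc')
    have s2 : sta (snocP γ p c) (p+1) = mv d S := by rw [sta_snocP', g3, mv_mv]
    have p1' : IsPath (snocP (snocP γ p d) (p+1) c) (p+2) := p1.snocP (by rw [s1]; exact ad_mv hRc)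
    have s1' : sta (snocP (snocP γ p d) (p+1) c) (p+2) = S := by rw [sta_snocP', s1, mv_mv]
    have p2' : IsPath (snocP (snocP γ p c) (p+1) d) (p+2) := p2.snocP (by rw [s2]; exact ad_mv hRd)
    have s2' : sta (snocP (snocP γ p c) (p+1) d) (p+2) = S := by rw [sta_snocP', s2, mv_mv]
    have q1 := step _ _ ha p1' (by rw [s1']) (by rw [snocP_self]) hQ
    have v1 : snocP (snocP γ p d) (p+1) c p = d := by rw [snocP_lt (by omega), snocP_self]
    have v2 : snocP (snocP γ p d) (p+1) c (p+1) = c := snocP_self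
    have q2 := hsw _ p (by omega) (by rw [v1, v2]; exact Ne.symm hm) (by rw [v1, v2]; exact f1)
      (by rw [v1, v2]; exact f2) q1
    have q3 : Q (snocP (snocP γ p c) (p+1) d) := by
      refine hcg _ _ ?_ q2
      intro k hk
      simp only [Function.comp]
      by_cases k1 : k = p
      · subst k1
        rw [Equiv.swap_apply_left, v2, snocP_lt (by omega), snocP_self]
      by_cases k2 : k = p + 1
      · subst k2
        rw [Equiv.swap_apply_right, v1, snocP_self]
      rw [Equiv.swap_apply_of_ne_of_ne k1 k2, snocP_lt (by omega), snocP_lt (by omega), snocP_lt (by omega),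
        snocP_lt (by omega)]
    exact step _ _ p2' hb (by rw [s2', hst]) (by rw [snocP_self]) q3

/-- finset of all paths to a state -/
lemma exists_paths (m : ℕ) : ∀ S, ∃ P : Finset (ℕ → ℤ), (Reach m S → P.card = fn m S) ∧
    ∀ α ∈ P, (Reach m S → IsPath α m ∧ sta α m = S) ∧ ∀ k, m ≤ k → α k = 0 := by
  classical
  induction m with
  | zero =>
    intro S
    refine ⟨{fun _ => 0}, ?_, ?_⟩
    · intro h; rw [Reach] at h; simp [fn, h]
    · intro α h
      rw [mem_singleton] at h
      subst h
      exact ⟨fun h => ⟨fun k hk => by omega, h.symm⟩, fun _ _ => rfl⟩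
  | succ m ih =>
    choose P hP1 hP2 using ih
    intro S
    refine ⟨(Rs (m+1) S).biUnion fun c => (P (mv c S)).image fun α => snocP α m c, ?_, ?_⟩
    · intro h
      rw [Finset.card_biUnion, fn]
      · refine Finset.sum_congr rfl fun c hc => ?_
        rw [mem_Rs h] at hc
        rw [Finset.card_image_of_injOn, hP1 _ (reach_rm' h hc)]
        intro α ha β hb hab
        funext k
        by_cases hk : k < m
        · have := congrFun hab k
          simp only at this
          rwa [snocP_lt hk, snocP_lt hk] at this
        · rw [(hP2 _ α ha).2 k (by omega), (hP2 _ β hb).2 k (by omega)]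
      · intro c _ d _ hcd
        rw [Function.onFun, Finset.disjoint_left]
        intro α h1 h2
        simp only [mem_image] at h1 h2
        obtain ⟨a, _, rfl⟩ := h1
        obtain ⟨b, _, h⟩ := h2
        have := congrFun h m
        rw [snocP_self, snocP_self] at this
        exact hcd this.symm
    · intro α hα
      simp only [mem_biUnion, mem_image] at hα
      obtain ⟨c, hc, β, hβ, rfl⟩ := hα
      constructor
      · intro h
        rw [mem_Rs h] at hc
        obtain ⟨h1, h2⟩ := (hP2 _ β hβ).1 (reach_rm' h hc)
        exact ⟨h1.snocP (by rw [h2]; exact ad_mv hc), by rw [sta_snocP', h2, mv_mv]⟩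
      · intro k hk; exact snocP_gt (by omega)


/-- abstract data of Jucys-Murphy operators with an invariant hermitian form -/
structure OV (V : Type) [AddCommGroup V] [Module ℂ V] (n : ℕ) where
  s : ℕ → V →ₗ[ℂ] V
  X : ℕ → V →ₗ[ℂ] V
  H : V → V →ₗ[ℂ] ℂ
  s_sq : ∀ i, i + 1 < n → ∀ v, s i (s i v) = v
  sX1 : ∀ i, i + 1 < n → ∀ v, X (i+1) (s i v) = s i (X i v) + v
  sX0 : ∀ i k, i + 1 < n → k < n → k ≠ i → k ≠ i + 1 → ∀ v, X k (s i v) = s i (X k v)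
  braid : ∀ i, i + 2 < n → ∀ v, s i (s (i+1) (s i v)) = s (i+1) (s i (s (i+1) v))
  X_zero : ∀ v, X 0 v = 0
  X_comm : ∀ j k, j < n → k < n → ∀ v, X j (X k v) = X k (X j v)
  H_symm : ∀ u v, H v u = star (H u v)
  H_def : ∀ v, H v v = 0 → v = 0
  s_adj : ∀ i, i + 1 < n → ∀ u v, H (s i u) v = H u (s i v)
  X_adj : ∀ i, i < n → ∀ u v, H (X i u) v = H u (X i v)

lemma sq_eq_one' {R : Type*} [CommRing R] [IsDomain R] {x : R} (h : x^2 = 1) : x = 1 ∨ x = -1 := by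
  rw [← one_pow 2] at h
  exact sq_eq_sq_iff_eq_or_eq_neg.1 h

namespace OV
variable {V : Type} [AddCommGroup V] [Module ℂ V] {n : ℕ} (O : OV V n)

def IsWt (β : ℕ → ℂ) (v : V) : Prop := v ≠ 0 ∧ ∀ k < n, O.X k v = β k • v

lemma H_smul (c : ℂ) (u v : V) : O.H (c • u) v = star c * O.H u v := by
  rw [O.H_symm, map_smul, smul_eq_mul, star_mul', ← O.H_symm]
lemma H_sub (u w v : V) : O.H (u - w) v = O.H u v - O.H w v := by
  rw [O.H_symm, map_sub, star_sub, ← O.H_symm, ← O.H_symm]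

variable {O}

lemma wt_H {β : ℕ → ℂ} {v : V} (h : O.IsWt β v) : O.H v v ≠ 0 := fun e => h.1 (O.H_def v e)

lemma wt_real {β : ℕ → ℂ} {v : V} (h : O.IsWt β v) {k : ℕ} (hk : k < n) : star (β k) = β k := by
  have := O.X_adj k hk v v
  rw [h.2 k hk, H_smul, map_smul, smul_eq_mul] at this
  exact mul_right_cancel₀ (wt_H h) this

lemma wt_key {β : ℕ → ℂ} {v : V} (h : O.IsWt β v) {i : ℕ} (hi : i + 1 < n) :
    (β (i+1) - β i) * O.H v (O.s i v) = O.H v v := by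
  have h1 := O.X_adj (i+1) hi v (O.s i v)
  rw [O.sX1 i hi, h.2 (i+1) hi, h.2 i (by omega), H_smul, wt_real h hi, map_add, map_smul, map_smul, smul_eq_mul] at h1
  rw [sub_mul, h1]; ring

lemma wt_ne {β : ℕ → ℂ} {v : V} (h : O.IsWt β v) {i : ℕ} (hi : i + 1 < n) : β (i+1) ≠ β i := by
  intro e
  have := wt_key h hi
  rw [e, sub_self, zero_mul] at this
  exact wt_H h this.symm

lemma wt_pm {β : ℕ → ℂ} {v : V} (h : O.IsWt β v) {i : ℕ} (hi : i + 1 < n) {ε : ℂ} (hε : ε = 1 ∨ ε = -1)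
    (hb : β (i+1) = β i + ε) : O.s i v = ε • v := by
  have h1 := wt_key h hi
  rw [hb, add_sub_cancel_left] at h1
  have h2 : O.H (O.s i v) (O.s i v) = O.H v v := by rw [O.s_adj i hi, O.s_sq i hi]
  have h3 : O.H (O.s i v) v = O.H v (O.s i v) := O.s_adj i hi v v
  have : O.s i v - ε • v = 0 := by
    apply O.H_def
    rw [H_sub, map_sub, map_sub, h2, H_smul, H_smul, map_smul, map_smul, h3]
    rcases hε with rfl | rfl
    · simp at h1 ⊢; rw [h1]; ring
    · simp at h1 ⊢; rw [← h1]; ring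
  exact sub_eq_zero.1 this

lemma wt_swap {β : ℕ → ℂ} {v : V} (h : O.IsWt β v) {i : ℕ} (hi : i + 1 < n)
    (hb : (β (i+1) - β i)^2 ≠ 1) : ∃ w, O.IsWt (β ∘ Equiv.swap i (i+1)) w := by
  have hne : β (i+1) - β i ≠ 0 := sub_ne_zero.2 (wt_ne h hi)
  obtain ⟨r, hr⟩ : ∃ r, (β (i+1) - β i) * r = 1 := ⟨_, mul_inv_cancel₀ hne⟩
  refine ⟨O.s i v - r • v, ?_, ?_⟩
  · intro e
    have e1 : O.s i v = r • v := sub_eq_zero.1 e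
    have e2 := O.s_sq i hi v
    rw [e1, map_smul, e1, smul_smul] at e2
    have e3 : (r * r - 1) • v = 0 := by rw [sub_smul, e2, one_smul, sub_self]
    rcases smul_eq_zero.1 e3 with e4 | e4
    · apply hb
      have : ((β (i+1) - β i) * r)^2 = 1 := by rw [hr, one_pow]
      rw [mul_pow] at this
      have e5 : r^2 = 1 := by rw [pow_two]; exact sub_eq_zero.1 e4
      rwa [e5, mul_one] at this
    · exact h.1 e4
  · intro k hk
    by_cases k1 : k = i + 1
    · subst k1
      simp only [Function.comp, Equiv.swap_apply_right]
      rw [map_sub, map_smul, O.sX1 i hi, h.2 _ hk, h.2 i (by omega), map_smul]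
      have : β (i+1) = β i + (β (i+1) - β i) := by ring
      rw [this, smul_smul, mul_add, mul_comm r (_ - _), hr]
      module
    by_cases k2 : k = i
    · subst k2
      simp only [Function.comp, Equiv.swap_apply_left]
      have e := O.sX1 k hi (O.s k v)
      rw [O.s_sq k hi, h.2 _ hi] at e
      have e2 := congrArg (O.s k) e
      rw [map_add, O.s_sq k hi, map_smul, O.s_sq k hi] at e2
      have e3 : O.X k (O.s k v) = β (k+1) • O.s k v - v := by rw [e2]; abel
      rw [map_sub, map_smul, e3, h.2 k hk]
      have : β k = β (k+1) - (β (k+1) - β k) := by ring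
      rw [this, smul_smul, mul_sub, mul_comm r (_ - _), hr]
      module
    · simp only [Function.comp, Equiv.swap_apply_of_ne_of_ne k2 k1]
      rw [map_sub, map_smul, O.sX0 i k hi hk k2 k1, h.2 k hk, map_smul]
      module

lemma wt_braid {β : ℕ → ℂ} {v : V} (h : O.IsWt β v) {i : ℕ} (hi : i + 2 < n) {ε : ℂ} (hε : ε = 1 ∨ ε = -1)
    (hb : β (i+1) = β i + ε) (hc : β (i+2) = β i) : False := by
  have h1 := wt_pm h (show i + 1 < n by omega) hε hb
  have h2 := wt_pm h (i := i+1) (by omega) (ε := -ε) (by rcases hε with rfl | rfl <;> simp) (by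
    show β (i+2) = _
    rw [hc, hb]; ring)
  have h3 := O.braid i hi v
  rw [h1, h2] at h3
  simp only [map_smul, h1, h2, smul_smul] at h3
  apply h.1
  rcases hε with rfl | rfl
  · norm_num at h3
    have : (2:ℂ) • v = 0 := by rw [two_smul]; nth_rewrite 1 [← h3]; simp
    simpa using this
  · norm_num at h3
    have : (2:ℂ) • v = 0 := by rw [two_smul]; nth_rewrite 1 [h3]; simp
    simpa using this

lemma IsWt.congr {β β' : ℕ → ℂ} {v : V} (h : O.IsWt β v) (e : ∀ k < n, β k = β' k) : O.IsWt β' v :=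
  ⟨h.1, fun k hk => by rw [← e k hk]; exact h.2 k hk⟩

lemma wt_swapZ {α : ℕ → ℤ} {i : ℕ} (h1 : α i ≠ α (i+1) + 1) (h2 : α (i+1) ≠ α i + 1) :
    ((α (i+1) : ℂ) - α i)^2 ≠ 1 := by
  intro e
  have : ((α (i+1)) - α i)^2 = 1 := by exact_mod_cast e
  rcases sq_eq_one' this with h | h <;> omega

lemma wt_conn {α α' : ℕ → ℤ} {p : ℕ} (hp : p ≤ n) {β : ℕ → ℂ} (ha : IsPath α p) (ha' : IsPath α' p)
    (hst : sta α p = sta α' p) (hw : ∃ v, O.IsWt (fun k => if k < p then (α k : ℂ) else β k) v) :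
    ∃ v, O.IsWt (fun k => if k < p then (α' k : ℂ) else β k) v := by
  refine conn p (fun a => ∃ v, O.IsWt (fun k => if k < p then (a k : ℂ) else β k) v) ?_ ?_ α α' ha ha' hst hw
  · rintro a b h ⟨v, hv⟩
    refine ⟨v, hv.congr fun k hk => ?_⟩
    by_cases hkp : k < p
    · simp [hkp, h k hkp]
    · simp [hkp]
  · rintro a i hi h0 h1 h2 ⟨v, hv⟩
    obtain ⟨w, hw⟩ := wt_swap hv (i := i) (by omega) (by
      simp only [show i < p by omega, show i + 1 < p by omega, if_true]
      exact wt_swapZ h1 h2)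
    refine ⟨w, hw.congr fun k hk => ?_⟩
    have : Equiv.swap i (i+1) k < p ↔ k < p := by
      rw [Equiv.swap_apply_def]; split_ifs <;> omega
    simp only [Function.comp, this]
    split_ifs with hkp
    · rfl
    · rw [Equiv.swap_apply_of_ne_of_ne (by omega) (by omega)]

theorem wt_path {p : ℕ} (hp : p ≤ n) : ∀ {β : ℕ → ℂ} {v : V}, O.IsWt β v →
    ∃ α : ℕ → ℤ, IsPath α p ∧ ∀ k < p, β k = α k := by
  induction p with
  | zero => intro β v h; exact ⟨fun _ => 0, fun k hk => by omega, fun k hk => by omega⟩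
  | succ p ih =>
    intro β v h
    obtain rfl | ⟨p, rfl⟩ : p = 0 ∨ ∃ q, p = q + 1 := by cases p <;> simp
    · refine ⟨fun _ => 0, ?_, ?_⟩
      · intro k hk
        obtain rfl : k = 0 := by omega
        simp [sta, Ad, vac]
      · intro k hk
        obtain rfl : k = 0 := by omega
        have := h.2 0 (by omega)
        rw [O.X_zero] at this
        rcases smul_eq_zero.1 this.symm with e | e
        · simp [e]
        · exact absurd e h.1
    obtain ⟨α, ha, hab⟩ := ih (by omega) h
    suffices hs : ∃ c : ℤ, β (p+1) = c ∧ Ad c (sta α (p+1)) by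
      obtain ⟨c, hc, hA⟩ := hs
      refine ⟨snocP α (p+1) c, ha.snocP hA, ?_⟩
      intro k hk
      by_cases hk1 : k < p + 1
      · rw [snocP_lt hk1, hab k hk1]
      · obtain rfl : k = p + 1 := by omega
        rw [snocP_self, hc]
    have hd := hab p (by omega)
    have hne := wt_ne h (i := p) (by omega)
    have hAd := ha p (by omega)
    by_cases hsq : (β (p+1) - β p)^2 = 1
    · obtain ⟨ε, hε, hx⟩ : ∃ ε : ℤ, (ε = 1 ∨ ε = -1) ∧ β (p+1) = β p + ε := by
        rcases sq_eq_one' hsq with e | e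
        · exact ⟨1, by simp, by push_cast; linear_combination e⟩
        · exact ⟨-1, by simp, by push_cast; linear_combination e⟩
      refine ⟨α p + ε, by rw [hx, hd]; push_cast; rfl, ?_⟩
      by_contra hA
      have hR : Rm (α p + ε) (sta α p) := by
        rw [sta] at hA
        obtain ⟨a1, a2⟩ := hAd
        rcases hε with rfl | rfl
        · refine ⟨a2, ?_⟩
          by_contra hf
          apply hA
          refine ⟨by rw [mv_succ]; exact a1, ?_⟩
          rw [mv_ne _ _ _ (by omega) (by omega)]
          simpa using hf
        · refine ⟨?_, by simpa using a1⟩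
          by_contra hf
          apply hA
          refine ⟨?_, ?_⟩
          · rw [mv_ne _ _ _ (by omega) (by omega)]
            simpa using hf
          · rw [show α p + -1 + 1 = α p by ring, mv_self]; exact a2
      obtain ⟨q, rfl, hq⟩ := reach_rm (ha.mono (show p ≤ p + 1 by omega)).reach hR
      obtain ⟨γ, g1, g2⟩ := hq.path
      set c := α (q+1) + ε with hc
      have p1 : IsPath (snocP γ q c) (q+1) := g1.snocP (by rw [g2]; exact ad_mv hR)
      have s1 : sta (snocP γ q c) (q+1) = sta α (q+1) := by rw [sta_snocP', g2, mv_mv]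
      obtain ⟨w, hw⟩ := wt_conn (O := O) (β := β) (show q + 1 ≤ n by omega) (ha.mono (by omega)) p1 s1.symm
        ⟨v, h.congr fun k hk => by
          by_cases hk1 : k < q + 1
          · simp [hk1, hab k (by omega)]
          · simp [hk1]⟩
      refine wt_braid hw (i := q) (by omega) (ε := -ε) (by rcases hε with rfl | rfl <;> simp) ?_ ?_
      · simp [snocP_self, hd, hc]
      · simp only [show ¬ q + 2 < q + 1 by omega, show q < q + 1 by omega, if_true, if_false, snocP_self]
        rw [show q + 2 = q + 1 + 1 by rfl, hx, hd, hc]; push_cast; rfl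
    · obtain ⟨w, hw⟩ := wt_swap h (i := p) (by omega) hsq
      obtain ⟨α', ha', hab'⟩ := ih (by omega) hw
      have e1 : ∀ k < p, α' k = α k := by
        intro k hk
        have := hab' k (by omega)
        simp only [Function.comp] at this
        rw [Equiv.swap_apply_of_ne_of_ne (by omega) (by omega), hab k (by omega)] at this
        exact_mod_cast this.symm
      have e2 : β (p+1) = α' p := by
        have := hab' p (by omega)
        simpa using this
      refine ⟨α' p, e2, ?_⟩
      have hA := ha' p (by omega)
      rw [sta_congr e1] at hA
      rw [e2, hd] at hsq hne
      rw [sta, ad_far]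
      · exact hA
      · exact_mod_cast hne
      · intro e; apply hsq; rw [e]; push_cast; ring
      · intro e; apply hsq; rw [e]; push_cast; ring

lemma exists_wt [FiniteDimensional ℂ V] [Nontrivial V] : ∃ β v, O.IsWt β v := by
  have key : ∀ m ≤ n, ∃ (β : ℕ → ℂ) (v : V), v ≠ 0 ∧ ∀ k < m, O.X k v = β k • v := by
    intro m
    induction m with
    | zero => intro _; obtain ⟨v, hv⟩ := exists_ne (0:V); exact ⟨fun _ => 0, v, hv, fun k hk => by omega⟩
    | succ m ih =>
      intro hm
      obtain ⟨β, v, hv, h⟩ := ih (by omega)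
      let E : Submodule ℂ V :=
        { carrier := {u | ∀ k < m, O.X k u = β k • u}
          add_mem' := fun {a b} ha hb k hk => by rw [map_add, ha k hk, hb k hk, smul_add]
          zero_mem' := fun k hk => by simp
          smul_mem' := fun c a ha k hk => by rw [map_smul, ha k hk, smul_comm] }
      have hE : ∀ u ∈ E, O.X m u ∈ E := by
        intro u hu k hk
        rw [O.X_comm k m (by omega) (by omega), hu k hk, map_smul]
      have : Nontrivial E := ⟨⟨⟨v, h⟩, 0, fun e => hv (congrArg Subtype.val e)⟩⟩
      obtain ⟨c, hc⟩ := Module.End.exists_eigenvalue ((O.X m).restrict hE)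
      obtain ⟨⟨u, hu⟩, hc1⟩ := hc.exists_hasEigenvector
      refine ⟨fun k => if k = m then c else β k, u, fun e => hc1.2 (Subtype.ext e), ?_⟩
      intro k hk
      by_cases hkm : k = m
      · subst hkm
        have := congrArg Subtype.val hc1.apply_eq_smul
        simpa using this
      · simp only [hkm, if_false]
        exact hu k (by omega)
  obtain ⟨β, v, h⟩ := key n le_rfl
  exact ⟨β, v, h⟩

theorem shape [FiniteDimensional ℂ V] [Nontrivial V] : ∃ S, Reach n S ∧ fn n S ≤ Module.finrank ℂ V ∧
    ∀ α : ℕ → ℤ, IsPath α n → sta α n = S → ∃ v, O.IsWt (fun k => (α k : ℂ)) v := by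
  obtain ⟨β, v, hv⟩ := exists_wt (O := O)
  obtain ⟨α, ha, hab⟩ := wt_path le_rfl hv
  have hall : ∀ α' : ℕ → ℤ, IsPath α' n → sta α' n = sta α n → ∃ v, O.IsWt (fun k => (α' k : ℂ)) v := by
    intro α' ha' hst
    obtain ⟨w, hw⟩ := wt_conn (O := O) (β := fun _ => 0) le_rfl ha ha' hst.symm ⟨v, hv.congr fun k hk => by
      simp [hk, hab k hk]⟩
    exact ⟨w, hw.congr fun k hk => by simp [hk]⟩
  refine ⟨sta α n, ha.reach, ?_, hall⟩
  obtain ⟨P, hP1, hP2⟩ := exists_paths n (sta α n)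
  rw [← hP1 ha.reach]
  have h1 : ∀ a : P, ∃ v, O.IsWt (fun k => (a.1 k : ℂ)) v := fun a =>
    hall a.1 ((hP2 a.1 a.2).1 ha.reach).1 ((hP2 a.1 a.2).1 ha.reach).2
  choose w hw using h1
  have horth : ∀ a b : P, a ≠ b → O.H (w a) (w b) = 0 := by
    intro a b hne
    have : ∃ k < n, a.1 k ≠ b.1 k := by
      by_contra hcon
      push Not at hcon
      apply hne
      apply Subtype.ext
      funext k
      by_cases hk : k < n
      · exact hcon k hk
      · rw [(hP2 a.1 a.2).2 k (by omega), (hP2 b.1 b.2).2 k (by omega)]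
    obtain ⟨k, hk, hkne⟩ := this
    have e := O.X_adj k hk (w a) (w b)
    rw [(hw a).2 k hk, (hw b).2 k hk, H_smul, map_smul, smul_eq_mul, wt_real (hw a) hk] at e
    have : ((a.1 k : ℂ) - b.1 k) * O.H (w a) (w b) = 0 := by rw [sub_mul, e, sub_self]
    rcases mul_eq_zero.1 this with e1 | e1
    · exact absurd (by exact_mod_cast sub_eq_zero.1 e1) hkne
    · exact e1
  have hli : LinearIndependent ℂ w := by
    rw [Fintype.linearIndependent_iff]
    intro g hg a
    have e := congrArg (O.H (w a)) hg
    rw [map_sum, map_zero, Finset.sum_eq_single a] at e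
    · rw [map_smul, smul_eq_mul] at e
      exact (mul_eq_zero.1 e).resolve_right (wt_H (hw a))
    · intro b _ hb
      rw [map_smul, horth a b hb.symm, smul_zero]
    · simp
  have := hli.fintype_card_le_finrank
  simpa using this

end OV


section JMsec
variable {n : ℕ}

/-- group element in the group algebra -/
noncomputable def sg (g : Equiv.Perm (Fin n)) : MonoidAlgebra ℂ (Equiv.Perm (Fin n)) := MonoidAlgebra.single g 1

lemma sg_mul (g h : Equiv.Perm (Fin n)) : sg (g * h) = sg g * sg h := by
  rw [sg, sg, sg, MonoidAlgebra.single_mul_single, one_mul]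
lemma sg_one : sg (1 : Equiv.Perm (Fin n)) = 1 := rfl

/-- Jucys-Murphy elements -/
noncomputable def JM (k : Fin n) : MonoidAlgebra ℂ (Equiv.Perm (Fin n)) :=
  ∑ j ∈ univ.filter (fun j => j < k), sg (Equiv.swap j k)

lemma JM_comm_sg (k : Fin n) (g : Equiv.Perm (Fin n)) (hk : g k = k) (hg : ∀ j, j < k ↔ g j < k) :
    JM k * sg g = sg g * JM k := by
  rw [JM, Finset.sum_mul, Finset.mul_sum]
  symm
  refine Finset.sum_bij (fun j _ => g j) ?_ ?_ ?_ ?_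
  · intro j hj
    simp only [mem_filter, mem_univ, true_and] at hj ⊢
    exact (hg j).1 hj
  · intro a _ b _ h; exact g.injective h
  · intro b hb
    simp only [mem_filter, mem_univ, true_and] at hb
    refine ⟨g⁻¹ b, ?_, by simp⟩
    simp only [mem_filter, mem_univ, true_and]
    rw [hg]; simpa using hb
  · intro j _
    rw [← sg_mul, ← sg_mul]
    congr 1
    nth_rewrite 2 [← hk]
    rw [Equiv.swap_apply_apply]; simp

lemma JM_swap (a b : Fin n) (h : a.val + 1 = b.val) :
    JM b * sg (Equiv.swap a b) = sg (Equiv.swap a b) * JM a + 1 := by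
  have e : univ.filter (fun j => j < b) = insert a (univ.filter (fun j => j < a)) := by
    ext j
    simp only [mem_filter, mem_univ, true_and, mem_insert, Fin.lt_def, Fin.ext_iff]
    omega
  have hab : a ≠ b := by intro h'; subst h'; omega
  rw [JM, e, Finset.sum_insert (by simp), add_mul, ← sg_mul, Equiv.swap_mul_self, sg_one, add_comm]
  congr 1
  rw [JM, Finset.sum_mul, Finset.mul_sum]
  refine Finset.sum_congr rfl fun j hj => ?_
  simp only [mem_filter, mem_univ, true_and] at hj
  rw [← sg_mul, ← sg_mul]
  congr 1
  have : Equiv.swap j b = Equiv.swap (Equiv.swap a b j) (Equiv.swap a b a) := by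
    rw [Equiv.swap_apply_left, Equiv.swap_apply_of_ne_of_ne hj.ne]
    rintro rfl
    rw [Fin.lt_def] at hj; omega
  rw [this, Equiv.swap_apply_apply]; simp

lemma JM_comm_swap (a b k : Fin n) (h : a.val + 1 = b.val) (ha : k ≠ a) (hb : k ≠ b) :
    JM k * sg (Equiv.swap a b) = sg (Equiv.swap a b) * JM k := by
  refine JM_comm_sg k _ (Equiv.swap_apply_of_ne_of_ne ha hb) ?_
  intro j
  rw [Equiv.swap_apply_def]
  split_ifs with h1 h2
  · subst h1; rw [Fin.lt_def, Fin.lt_def]; rw [Ne, Fin.ext_iff] at ha hb; omega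
  · subst h2; rw [Fin.lt_def, Fin.lt_def]; rw [Ne, Fin.ext_iff] at ha hb; omega
  · rfl

lemma JM_comm' (j k : Fin n) (h : j < k) : JM k * JM j = JM j * JM k := by
  rw [show JM j = ∑ i ∈ univ.filter (fun i => i < j), sg (Equiv.swap i j) from rfl, Finset.sum_mul, Finset.mul_sum]
  refine Finset.sum_congr rfl fun i hi => ?_
  simp only [mem_filter, mem_univ, true_and] at hi
  refine JM_comm_sg k _ (Equiv.swap_apply_of_ne_of_ne (hi.trans h).ne' h.ne') ?_
  intro l
  rw [Equiv.swap_apply_def]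
  split_ifs with h1 h2
  · subst h1; exact ⟨fun _ => h, fun _ => hi.trans h⟩
  · subst h2; exact ⟨fun _ => hi.trans h, fun _ => h⟩
  · rfl

lemma JM_comm (j k : Fin n) : JM j * JM k = JM k * JM j := by
  rcases lt_trichotomy j k with h | h | h
  · exact (JM_comm' j k h).symm
  · rw [h]
  · exact JM_comm' k j h

lemma sg_braid (a b c : Fin n) (h1 : a ≠ b) (h2 : b ≠ c) (h3 : a ≠ c) :
    sg (Equiv.swap a b) * (sg (Equiv.swap b c) * sg (Equiv.swap a b)) =
    sg (Equiv.swap b c) * (sg (Equiv.swap a b) * sg (Equiv.swap b c)) := by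
  simp only [← sg_mul]
  congr 1
  rw [← mul_assoc, ← mul_assoc]
  have e1 := Equiv.swap_mul_swap_mul_swap (x := c) (y := b) (z := a) h2.symm h3.symm
  have e2 := Equiv.swap_mul_swap_mul_swap (x := a) (y := b) (z := c) h1 h3
  rw [Equiv.swap_comm c b, Equiv.swap_comm b a] at e1
  rw [e1, e2, Equiv.swap_comm]

/-- adjacent transposition, indexed by naturals -/
noncomputable def sN (n i : ℕ) : MonoidAlgebra ℂ (Equiv.Perm (Fin n)) :=
  if h : i + 1 < n then sg (Equiv.swap ⟨i, by omega⟩ ⟨i+1, h⟩) else 1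
noncomputable def XN (n k : ℕ) : MonoidAlgebra ℂ (Equiv.Perm (Fin n)) :=
  if h : k < n then JM ⟨k, h⟩ else 0

variable {m : ℕ} {d : Fin m → ℕ}
  (φ : MonoidAlgebra ℂ (Equiv.Perm (Fin n)) ≃ₐ[ℂ] Π i, Matrix (Fin (d i)) (Fin (d i)) ℂ) (i : Fin m)

noncomputable def Tφ (x : MonoidAlgebra ℂ (Equiv.Perm (Fin n))) : (Fin (d i) → ℂ) →ₗ[ℂ] (Fin (d i) → ℂ) :=
  (φ x i).mulVecLin

lemma T_mul (x y : MonoidAlgebra ℂ (Equiv.Perm (Fin n))) (v) : Tφ φ i (x * y) v = Tφ φ i x (Tφ φ i y v) := by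
  simp [Tφ]
lemma T_one (v) : Tφ φ i 1 v = v := by simp [Tφ]
lemma T_add (x y : MonoidAlgebra ℂ (Equiv.Perm (Fin n))) (v) : Tφ φ i (x + y) v = Tφ φ i x v + Tφ φ i y v := by
  simp [Tφ]
lemma T_zero (v) : Tφ φ i 0 v = 0 := by
  simp [Tφ]
lemma T_smul (c : ℂ) (x : MonoidAlgebra ℂ (Equiv.Perm (Fin n))) (v) : Tφ φ i (c • x) v = c • Tφ φ i x v := by
  simp [Tφ]
lemma T_sum {ι : Type*} (s : Finset ι) (f : ι → MonoidAlgebra ℂ (Equiv.Perm (Fin n))) (v) :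
    Tφ φ i (∑ j ∈ s, f j) v = ∑ j ∈ s, Tφ φ i (f j) v := by
  simp [Tφ]

noncomputable def Hφ (u : Fin (d i) → ℂ) : (Fin (d i) → ℂ) →ₗ[ℂ] ℂ where
  toFun w := ∑ g : Equiv.Perm (Fin n), star (Tφ φ i (sg g) u) ⬝ᵥ (Tφ φ i (sg g) w)
  map_add' a b := by simp only [map_add, dotProduct_add, Finset.sum_add_distrib]
  map_smul' c a := by simp only [map_smul, dotProduct_smul, smul_eq_mul, Finset.mul_sum, RingHom.id_apply]

lemma H_apply (u w) : Hφ φ i u w = ∑ g : Equiv.Perm (Fin n), star (Tφ φ i (sg g) u) ⬝ᵥ (Tφ φ i (sg g) w) := rfl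

lemma H_inv (h : Equiv.Perm (Fin n)) (u w) : Hφ φ i (Tφ φ i (sg h) u) w = Hφ φ i u (Tφ φ i (sg h⁻¹) w) := by
  rw [H_apply, H_apply]
  rw [← Equiv.sum_comp (Equiv.mulRight h⁻¹)]
  refine Finset.sum_congr rfl fun g _ => ?_
  simp only [Equiv.coe_mulRight, ← T_mul, ← sg_mul]
  simp

lemma H_swap (a b : Fin n) (u w) : Hφ φ i (Tφ φ i (sg (Equiv.swap a b)) u) w = Hφ φ i u (Tφ φ i (sg (Equiv.swap a b)) w) := by
  rw [H_inv, Equiv.swap_inv]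

lemma Hφ_symm (u w) : Hφ φ i w u = star (Hφ φ i u w) := by
  rw [H_apply, H_apply, star_sum]
  refine Finset.sum_congr rfl fun g _ => ?_
  rw [← Matrix.star_dotProduct_star, star_star]

open ComplexOrder in
lemma Hφ_def (v) (h : Hφ φ i v v = 0) : v = 0 := by
  rw [H_apply, Finset.sum_eq_zero_iff_of_nonneg (fun g _ => dotProduct_star_self_nonneg _)] at h
  have := h 1 (mem_univ _)
  rw [dotProduct_star_self_eq_zero, sg_one, T_one] at this
  exact this

lemma Hφ_JM (k : Fin n) (u w) : Hφ φ i (Tφ φ i (JM k) u) w = Hφ φ i u (Tφ φ i (JM k) w) := by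
  rw [JM, T_sum, T_sum, map_sum, Hφ_symm, map_sum, star_sum]
  refine Finset.sum_congr rfl fun j _ => ?_
  rw [← Hφ_symm, H_swap]

/-- the structure for a block -/
noncomputable def bOV : OV (Fin (d i) → ℂ) n where
  s j := Tφ φ i (sN n j)
  X k := Tφ φ i (XN n k)
  H := Hφ φ i
  s_sq j hj v := by
    rw [sN, dif_pos hj, ← T_mul, ← sg_mul, Equiv.swap_mul_self, sg_one, T_one]
  sX1 j hj v := by
    rw [sN, dif_pos hj, XN, dif_pos hj, XN, dif_pos (by omega), ← T_mul, ← T_mul, JM_swap _ _ rfl, T_add, T_one]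
  sX0 j k hj hk h1 h2 v := by
    rw [sN, dif_pos hj, XN, dif_pos hk, ← T_mul, ← T_mul, JM_comm_swap _ _ _ rfl]
    · simpa [Fin.ext_iff] using h1
    · simpa [Fin.ext_iff] using h2
  braid j hj v := by
    rw [sN, dif_pos (by omega), sN, dif_pos (by omega)]
    simp only [← T_mul]
    rw [sg_braid _ _ _ (by simp) (by simp) (by simp; omega)]
  X_zero v := by
    unfold XN
    split_ifs with h
    · rw [JM, T_sum, Finset.sum_eq_zero]
      intro j hj
      simp [Fin.lt_def] at hj
    · exact T_zero φ i v
  X_comm j k hj hk v := by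
    rw [XN, dif_pos hj, XN, dif_pos hk, ← T_mul, ← T_mul, JM_comm]
  H_symm u v := Hφ_symm φ i u v
  H_def v h := Hφ_def φ i v h
  s_adj j hj u v := by rw [sN, dif_pos hj, H_swap]
  X_adj j hj u v := by rw [XN, dif_pos hj, Hφ_JM]

end JMsec


section JMsec4
variable {n : ℕ}

lemma adj_ind {P : Equiv.Perm (Fin n) → Prop} (h1 : P 1) (hm : ∀ a b, P a → P b → P (a * b))
    (hs : ∀ a b : Fin n, a.val + 1 = b.val → P (Equiv.swap a b)) (g : Equiv.Perm (Fin n)) : P g := by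
  obtain rfl | ⟨n, rfl⟩ : n = 0 ∨ ∃ k, n = k + 1 := by cases n <;> simp
  · rw [Subsingleton.elim g 1]; exact h1
  have hg : g ∈ Submonoid.closure (Set.range fun i : Fin n ↦ Equiv.swap i.castSucc i.succ) := by
    rw [Equiv.Perm.mclosure_swap_castSucc_succ]; trivial
  induction hg using Submonoid.closure_induction with
  | mem x hx => obtain ⟨i, rfl⟩ := hx; exact hs _ _ (by simp)
  | one => exact h1
  | mul x y _ _ hx hy => exact hm x y hx hy

variable {m : ℕ} {d : Fin m → ℕ}
  (φ : MonoidAlgebra ℂ (Equiv.Perm (Fin n)) ≃ₐ[ℂ] Π i, Matrix (Fin (d i)) (Fin (d i)) ℂ) (i : Fin m)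

lemma T_sg (g : Equiv.Perm (Fin n)) (v) : Tφ φ i (sg g) v = (rp φ i g).mulVec v := rfl

lemma triv_of_fix {v : Fin (d i) → ℂ} (hv : v ≠ 0)
    (hf : ∀ g ∈ alternatingGroup (Fin n), (rp φ i g).mulVec v = v) :
    ∀ h ∈ alternatingGroup (Fin n), rp φ i h = 1 := by
  classical
  obtain ⟨c, hc⟩ := comm_scalar φ i (∑ g, (if g ∈ alternatingGroup (Fin n) then rp φ i g else 0)) (by
    intro g
    rw [Finset.sum_mul, Finset.mul_sum]
    refine Fintype.sum_equiv (MulAut.conj g).toEquiv _ _ fun a => ?_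
    have : (MulAut.conj g) a ∈ alternatingGroup (Fin n) ↔ a ∈ alternatingGroup (Fin n) := by
      rw [MulAut.conj_apply]; exact (Subgroup.Normal.mem_comm_iff inferInstance).trans (by simp)
    simp only [MulEquiv.toEquiv_eq_coe, EquivLike.coe_coe, this]
    split_ifs
    · rw [← map_mul, ← map_mul]; simp
    · simp)
  have hc0 : c ≠ 0 := by
    rintro rfl
    rw [zero_smul] at hc
    have e := congrArg (fun M => Matrix.mulVec M v) hc
    simp only [Matrix.sum_mulVec, Matrix.zero_mulVec] at e
    have e2 : ∀ g, (if g ∈ alternatingGroup (Fin n) then rp φ i g else 0).mulVec v =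
        (if g ∈ alternatingGroup (Fin n) then (1:ℂ) else 0) • v := by
      intro g
      split_ifs with h
      · rw [hf g h, one_smul]
      · simp
    simp only [e2] at e
    rw [← Finset.sum_smul] at e
    rcases smul_eq_zero.1 e with e | e
    · rw [Finset.sum_boole] at e
      have : (univ.filter (fun g => g ∈ alternatingGroup (Fin n))).card = 0 := by exact_mod_cast e
      rw [Finset.card_eq_zero] at this
      have h1 : (1 : Equiv.Perm (Fin n)) ∈ univ.filter (fun g => g ∈ alternatingGroup (Fin n)) := by
        simp [Subgroup.one_mem]
      rw [this] at h1
      simp at h1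
    · exact hv e
  intro h hh
  have e : rp φ i h * (∑ g, (if g ∈ alternatingGroup (Fin n) then rp φ i g else 0)) =
      (∑ g, (if g ∈ alternatingGroup (Fin n) then rp φ i g else 0)) := by
    rw [Finset.mul_sum]
    refine Fintype.sum_equiv (Equiv.mulLeft h) _ _ fun a => ?_
    simp only [Equiv.coe_mulLeft, Subgroup.mul_mem_cancel_left _ hh]
    split_ifs
    · rw [map_mul]
    · simp
  rw [hc, mul_smul_comm, mul_one] at e
  exact smul_right_injective _ hc0 e

lemma fix_of_eps {v : Fin (d i) → ℂ} {ε : ℂ} (hε : ε = 1 ∨ ε = -1)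
    (hs : ∀ j, j + 1 < n → (bOV φ i).s j v = ε • v) :
    ∀ g ∈ alternatingGroup (Fin n), (rp φ i g).mulVec v = v := by
  have h2 : ∀ a b : Fin n, a.val + 1 = b.val → (rp φ i (Equiv.swap a b)).mulVec v = ε • v := by
    intro a b hab
    have := hs a.val (by omega)
    have e : (bOV φ i).s a.val v = Tφ φ i (sN n a.val) v := rfl
    rw [e, sN, dif_pos (by omega), T_sg] at this
    have hb : b = ⟨a.val + 1, by omega⟩ := Fin.ext hab.symm
    rw [hb]; exact this
  rcases hε with rfl | rfl
  · intro g _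
    refine adj_ind (P := fun g => (rp φ i g).mulVec v = v) ?_ ?_ ?_ g
    · simp
    · intro a b ha hb; rw [map_mul, ← Matrix.mulVec_mulVec, hb, ha]
    · intro a b hab; rw [h2 a b hab, one_smul]
  · intro g hg
    have := adj_ind (P := fun g => (rp φ i g).mulVec v = ((Equiv.Perm.sign g : ℤˣ) : ℤ) • v) ?_ ?_ ?_ g
    · rw [Equiv.Perm.mem_alternatingGroup] at hg
      rw [hg] at this; simpa using this
    · simp
    · intro a b ha hb
      rw [map_mul, ← Matrix.mulVec_mulVec, hb, Matrix.mulVec_smul, ha, smul_smul, Equiv.Perm.sign_mul]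
      congr 1; push_cast; ring
    · intro a b hab
      rw [h2 a b hab, Equiv.Perm.sign_swap (by intro h; subst h; omega)]
      simp

lemma triv_of_fn_one {S : MSt} (hr : Reach n S) (h1 : fn n S = 1)
    (hw : ∀ α : ℕ → ℤ, IsPath α n → sta α n = S → ∃ v, (bOV φ i).IsWt (fun k => (α k : ℂ)) v) :
    ∀ h ∈ alternatingGroup (Fin n), rp φ i h = 1 := by
  classical
  obtain ⟨ε, hε, v, hv⟩ : ∃ ε : ℤ, (ε = 1 ∨ ε = -1) ∧
      ∃ v, (bOV φ i).IsWt (fun k => ((ε * k : ℤ) : ℂ)) v := by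
    rcases fn_one hr h1 with h | h
    · refine ⟨1, by simp, ?_⟩
      have e : ∀ m, sta (fun k => 1 * (k:ℤ)) m = rowS m := by
        intro m
        induction m with
        | zero => rw [row_zero]; rfl
        | succ m ih => rw [sta, ih, one_mul, mv_row]
      exact hw (fun k => 1 * (k:ℤ)) (fun k _ => by rw [e]; simpa using ad_row' k) (by rw [e, h])
    · refine ⟨-1, by simp, ?_⟩
      have e : ∀ m, sta (fun k => -1 * (k:ℤ)) m = colS m := by
        intro m
        induction m with
        | zero => rw [col_zero]; rfl
        | succ m ih => rw [sta, ih, neg_one_mul, mv_col]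
      exact hw (fun k => -1 * (k:ℤ)) (fun k _ => by rw [e]; simpa using ad_col' k) (by rw [e, h])
  have hε' : (ε : ℂ) = 1 ∨ (ε : ℂ) = -1 := by rcases hε with rfl | rfl <;> simp
  refine triv_of_fix φ i hv.1 (fix_of_eps φ i hε' fun j hj => ?_)
  exact OV.wt_pm hv hj hε' (by push_cast; ring)

end JMsec4


section JMsec5
variable {n : ℕ} {W : Type} [AddCommGroup W] [Module ℂ W] [FiniteDimensional ℂ W]

lemma ortho (T : MonoidAlgebra ℂ (Equiv.Perm (Fin n)) →ₐ[ℂ] Module.End ℂ W) (H : W → W →ₗ[ℂ] ℂ)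
    (Hs : ∀ u v, H v u = star (H u v)) (Hd : ∀ v, H v v = 0 → v = 0)
    (Hi : ∀ g u v, H (T (sg g) u) v = H u (T (sg g⁻¹) v))
    (β : Fin n → ℂ) (hβ : ∀ k, star (β k) = β k) (w w' : W) (hw : ∀ k, T (JM k) w = β k • w)
    (hw' : ∀ k, T (JM k) w' = β k • w') (h0 : H w' w = 0) (m : ℕ) :
    ∀ g : Equiv.Perm (Fin n), (∀ x : Fin n, m ≤ x.val → g x = x) → H w' (T (sg g) w) = 0 := by
  have T_mul : ∀ x y v, T (x * y) v = T x (T y v) := fun x y v => by rw [map_mul]; rfl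
  have HJ : ∀ k u v, H (T (JM k) u) v = H u (T (JM k) v) := by
    intro k u v
    rw [JM, map_sum, LinearMap.sum_apply, LinearMap.sum_apply, map_sum, Hs, map_sum, star_sum]
    refine Finset.sum_congr rfl fun j _ => ?_
    rw [← Hs, Hi, Equiv.swap_inv]
  have Hsm : ∀ (c : ℂ) u v, H (c • u) v = star c * H u v := by
    intro c u v
    rw [Hs, map_smul, smul_eq_mul, star_mul', ← Hs]
  induction m with
  | zero =>
    intro g hg
    have : g = 1 := Equiv.ext fun x => hg x (by omega)
    rw [this, sg_one, map_one]; exact h0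
  | succ m ih =>
    intro g hg
    by_cases hmn : n ≤ m
    · exact ih g fun x hx => by have := x.2; omega
    push Not at hmn
    set M : Fin n := ⟨m, hmn⟩ with hM
    by_cases hgM : g M = M
    · refine ih g fun x hx => ?_
      by_cases hxm : x = M
      · rw [hxm, hgM]
      · apply hg
        have : x.val ≠ m := fun h => hxm (Fin.ext h)
        omega
    -- the position moved to the top
    set q : Fin n := g⁻¹ M with hq
    have gq : g q = M := by simp [hq]
    have hqm : q.val < m := by
      by_contra hcon
      push Not at hcon
      rcases Nat.lt_or_ge m q.val with h | h
      · have := hg q (by omega)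
        rw [gq] at this; rw [← this] at h; simp [hM] at h
      · have : q = M := Fin.ext (by simp [hM]; omega)
        rw [this] at gq; exact hgM gq
    set P : Fin n := ⟨m - 1, by omega⟩ with hP
    have hPM : P.val + 1 = M.val := by simp [hP, hM]; omega
    set b : Equiv.Perm (Fin n) := Equiv.swap q P with hb
    have hbm : ∀ x : Fin n, m ≤ x.val → b x = x := by
      intro x hx
      apply Equiv.swap_apply_of_ne_of_ne
      · rintro rfl; omega
      · rintro rfl; simp [hP] at hx; omega
    set a : Equiv.Perm (Fin n) := g * b * Equiv.swap P M with ha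
    have ham : ∀ x : Fin n, m ≤ x.val → a x = x := by
      intro x hx
      by_cases hxm : x = M
      · rw [hxm, ha]; simp [hb, gq]
      · have hx1 : x.val ≠ m := fun h => hxm (Fin.ext h)
        rw [ha, Equiv.Perm.mul_apply, Equiv.Perm.mul_apply, Equiv.swap_apply_of_ne_of_ne _ hxm, hbm x hx, hg x (by omega)]
        rintro rfl; simp [hP] at hx; omega
    have hg2 : g = a * Equiv.swap P M * b := by
      rw [ha, mul_assoc (g * b), Equiv.swap_mul_self, mul_one, mul_assoc, hb, Equiv.swap_mul_self, mul_one]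
    set σ := Equiv.swap P M with hσ
    set c := β M with hc
    have hJs : ∀ v, T (JM M) (T (sg σ) v) = T (sg σ) (T (JM P) v) + v := by
      intro v
      rw [← T_mul, JM_swap P M hPM, map_add, map_one, LinearMap.add_apply, T_mul]; rfl
    -- commutation of JM M with small permutations
    have hcm : ∀ b : Equiv.Perm (Fin n), (∀ x : Fin n, m ≤ x.val → b x = x) → JM M * sg b = sg b * JM M := by
      intro b hb
      refine JM_comm_sg M b (hb M le_rfl) fun j => ?_
      rw [Fin.lt_def, Fin.lt_def]
      constructor
      · intro h
        by_contra hcon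
        have e := hb (b j) (by simp [hM] at hcon; omega)
        have := b.injective e
        rw [this] at hcon; exact hcon h
      · intro h
        by_contra hcon
        rw [hb j (by simp [hM] at hcon; omega)] at h
        exact hcon h
    let N : Submodule ℂ W := Submodule.span ℂ {y | ∃ b : Equiv.Perm (Fin n), (∀ x : Fin n, m ≤ x.val → b x = x) ∧ y = T (sg b) w}
    have hN1 : ∀ y ∈ N, T (JM M) y = c • y := by
      intro y hy
      induction hy using Submodule.span_induction with
      | mem y hy =>
        obtain ⟨b, hb, rfl⟩ := hy
        rw [← T_mul, hcm b hb, T_mul, hw, map_smul]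
      | zero => simp
      | add y z _ _ hy hz => rw [map_add, hy, hz, smul_add]
      | smul r y _ hy => rw [map_smul, hy, smul_comm]
    have hN2 : ∀ y ∈ N, T (JM P) y ∈ N := by
      intro y hy
      induction hy using Submodule.span_induction with
      | mem y hy =>
        obtain ⟨b, hb, rfl⟩ := hy
        rw [← T_mul, JM, Finset.sum_mul, map_sum, LinearMap.sum_apply]
        refine Submodule.sum_mem _ fun j hj => Submodule.subset_span ?_
        refine ⟨Equiv.swap j P * b, ?_, by rw [sg_mul]⟩
        intro x hx
        simp only [mem_filter, mem_univ, true_and, Fin.lt_def] at hj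
        rw [Equiv.Perm.mul_apply, hb x hx]
        apply Equiv.swap_apply_of_ne_of_ne
        · rintro rfl; simp [hP] at hj; omega
        · rintro rfl; simp [hP] at hx; omega
      | zero => simp
      | add y z _ _ hy hz => rw [map_add]; exact N.add_mem hy hz
      | smul r y _ hy => rw [map_smul]; exact N.smul_mem _ hy
    set x := T (sg a⁻¹) w' with hx
    have hxM : T (JM M) x = c • x := by
      rw [hx, ← T_mul, hcm, T_mul, hw', map_smul]
      intro y hy
      rw [Equiv.Perm.inv_eq_iff_eq, ham y hy]
    have hN3 : ∀ y ∈ N, H x y = 0 := by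
      intro y hy
      induction hy using Submodule.span_induction with
      | mem y hy =>
        obtain ⟨b, hb, rfl⟩ := hy
        rw [hx, Hi, inv_inv, ← T_mul, ← sg_mul]
        apply ih
        intro y hy
        rw [Equiv.Perm.mul_apply, hb y hy, ham y hy]
      | zero => simp
      | add y z _ _ hy hz => rw [map_add, hy, hz, add_zero]
      | smul r y _ hy => rw [map_smul, hy, smul_zero]
    let F : Module.End ℂ W := c • 1 - T (JM P)
    have hF : ∀ y, F y = c • y - T (JM P) y := fun y => rfl
    have hFN : ∀ y ∈ N, F y ∈ N := fun y hy => by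
      rw [hF]; exact N.sub_mem (N.smul_mem _ hy) (hN2 y hy)
    have hinj : Function.Injective (F.restrict hFN) := by
      rw [← LinearMap.ker_eq_bot, LinearMap.ker_eq_bot']
      rintro ⟨y, hy⟩ h
      have h1 : F y = 0 := congrArg Subtype.val h
      rw [hF, sub_eq_zero] at h1
      apply Subtype.ext
      apply Hd
      have e := HJ M y (T (sg σ) y)
      rw [hJs, ← h1, hN1 y hy, Hsm, hc, hβ, map_smul, map_add, map_smul, smul_eq_mul] at e
      simpa using e
    have hsurj := LinearMap.injective_iff_surjective.1 hinj
    have key : ∀ y ∈ N, H x (T (sg σ) y) = 0 := by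
      intro y hy
      obtain ⟨⟨z, hz⟩, hzy⟩ := hsurj ⟨y, hy⟩
      have h1 : F z = y := congrArg Subtype.val hzy
      have e := HJ M x (T (sg σ) z)
      rw [hJs, hxM, Hsm, hc, hβ, map_add, hN3 z hz, add_zero] at e
      rw [← h1, hF, map_sub, map_sub, map_smul, map_smul, smul_eq_mul, e, sub_self]
    have hgoal := key (T (sg b) w) (Submodule.subset_span ⟨b, hbm, rfl⟩)
    rw [hx, Hi, inv_inv, ← T_mul, ← T_mul, ← sg_mul, ← sg_mul, ← hg2] at hgoal
    exact hgoal

variable {m : ℕ} {d : Fin m → ℕ}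
  (φ : MonoidAlgebra ℂ (Equiv.Perm (Fin n)) ≃ₐ[ℂ] Π i, Matrix (Fin (d i)) (Fin (d i)) ℂ) (i j : Fin m)

noncomputable def TP : MonoidAlgebra ℂ (Equiv.Perm (Fin n)) →ₐ[ℂ] Module.End ℂ ((Fin (d i) → ℂ) × (Fin (d j) → ℂ)) :=
  AlgHom.ofLinearMap
    { toFun := fun x => (Tφ φ i x).prodMap (Tφ φ j x)
      map_add' := fun x y => LinearMap.ext fun v => by simp [T_add]
      map_smul' := fun c x => LinearMap.ext fun v => by simp [T_smul] }
    (by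
      refine LinearMap.ext fun v => ?_
      simp [T_one])
    (by
      intro x y
      refine LinearMap.ext fun v => ?_
      simp [T_mul])

lemma TP_apply (x) (v) : TP φ i j x v = (Tφ φ i x v.1, Tφ φ j x v.2) := rfl

noncomputable def HP (u : (Fin (d i) → ℂ) × (Fin (d j) → ℂ)) : ((Fin (d i) → ℂ) × (Fin (d j) → ℂ)) →ₗ[ℂ] ℂ :=
  (Hφ φ i u.1).coprod (Hφ φ j u.2)

lemma HP_apply (u v) : HP φ i j u v = Hφ φ i u.1 v.1 + Hφ φ j u.2 v.2 := rfl

open ComplexOrder in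
lemma Hφ_nonneg (v) : 0 ≤ Hφ φ i v v := by
  rw [H_apply]
  exact Finset.sum_nonneg fun g _ => dotProduct_star_self_nonneg _

open ComplexOrder in
lemma inj_aux (hij : i ≠ j) (β : Fin n → ℂ) (hβ : ∀ k, star (β k) = β k) (v : Fin (d i) → ℂ) (u : Fin (d j) → ℂ)
    (hv0 : v ≠ 0) (hu0 : u ≠ 0) (hv : ∀ k, Tφ φ i (JM k) v = β k • v) (hu : ∀ k, Tφ φ j (JM k) u = β k • u) : False := by
  have hH : Hφ φ j u u ≠ 0 := fun h => hu0 (Hφ_def φ j u h)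
  have hH' : Hφ φ i v v ≠ 0 := fun h => hv0 (Hφ_def φ i v h)
  obtain ⟨t, ht⟩ : ∃ t : ℂ, Hφ φ i v v + Hφ φ j (t • u) u = 0 := by
    refine ⟨star (- Hφ φ i v v / Hφ φ j u u), ?_⟩
    rw [Hφ_symm φ j u (_ • u), map_smul, smul_eq_mul, star_mul', star_star, ← Hφ_symm, div_mul_cancel₀ _ hH, add_neg_cancel]
  have key := ortho (TP φ i j) (HP φ i j) (fun a b => by
      rw [HP_apply, HP_apply, star_add, ← Hφ_symm, ← Hφ_symm]) (by
      rintro ⟨a, b⟩ h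
      rw [HP_apply] at h
      obtain ⟨h1, h2⟩ := (add_eq_zero_iff_of_nonneg (Hφ_nonneg φ i a) (Hφ_nonneg φ j b)).1 h
      rw [Hφ_def φ i a h1, Hφ_def φ j b h2]; rfl) (by
      intro g a b
      rw [HP_apply, HP_apply, TP_apply, TP_apply, H_inv, H_inv]) β hβ (v, u) (v, t • u) (by
      intro k; rw [TP_apply, hv, hu]; rfl) (by
      intro k; rw [TP_apply, map_smul, hv, hu, Prod.smul_mk, smul_comm]) (by
      rw [HP_apply]; exact ht) n
  have key2 : ∀ x, HP φ i j (v, t • u) (TP φ i j x (v, u)) = 0 := by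
    intro x
    have hx : x = ∑ g, x.coeff g • sg g := by
      ext h
      classical
      simp [sg]
    rw [hx, map_sum, LinearMap.sum_apply, map_sum]
    refine Finset.sum_eq_zero fun g _ => ?_
    rw [map_smul, LinearMap.smul_apply, map_smul, key g, smul_zero]
    intro x hx; have := x.2; omega
  classical
  have h := key2 (φ.symm (Pi.single i 1))
  rw [TP_apply, HP_apply] at h
  simp [Tφ, hij.symm] at h
  exact hH' h

end JMsec5


lemma wc_mem {n k : ℕ} (v : Fin k → Equiv.Perm (Fin n)) : wcG v ∈ alternatingGroup (Fin n) := by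
  rw [Equiv.Perm.mem_alternatingGroup, wcG, Equiv.Perm.sign_mul, map_list_prod, map_list_prod, List.map_ofFn, List.map_ofFn]
  have : (Equiv.Perm.sign ∘ fun i => (v i)⁻¹) = (Equiv.Perm.sign ∘ v) := by
    funext i; simp
  rw [this, ← pow_two]
  exact Int.units_sq _

lemma sum_pow_le' {ι : Type*} (s : Finset ι) (x : ι → ℝ) (hx : ∀ i ∈ s, 0 ≤ x i) (p : ℕ) :
    ∑ i ∈ s, x i ^ (p+1) ≤ (∑ i ∈ s, x i) ^ (p+1) := by
  rw [pow_succ (∑ i ∈ s, x i), Finset.mul_sum]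
  refine Finset.sum_le_sum fun i hi => ?_
  rw [pow_succ]
  refine mul_le_mul_of_nonneg_right ?_ (hx i hi)
  exact pow_le_pow_left₀ (hx i hi) (Finset.single_le_sum (f := x) hx hi) p

lemma main_bound {n k : ℕ} (hk : 2 ≤ k) (A : Set (Equiv.Perm (Fin n)))
    (hA : A ⊆ (alternatingGroup (Fin n) : Set (Equiv.Perm (Fin n)))) :
    ((Nat.card {v : Fin k → Equiv.Perm (Fin n) // wcG v ∈ A} : ℝ) / (n.factorial : ℝ) ^ k
          - (Nat.card A : ℝ) / (Nat.card (alternatingGroup (Fin n)) : ℝ))^2 ≤ (En n)^(2*(k/2)-1) := by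
  classical
  obtain ⟨m, d, hd, ⟨φ⟩⟩ := IsSemisimpleRing.exists_algEquiv_pi_matrix_of_isAlgClosed ℂ (MonoidAlgebra ℂ (Equiv.Perm (Fin n)))
  have hd0 : ∀ i, d i ≠ 0 := fun i => (hd i).ne
  let I : Finset (Fin m) := univ.filter fun i => ∃ h ∈ alternatingGroup (Fin n), rp φ i h ≠ 1
  have h1 := fourier_bound φ hd0 (alternatingGroup (Fin n)) k wc_mem A hA I (by
    intro i hi h hh
    by_contra hne
    exact hi (by simp only [I, mem_filter, mem_univ, true_and]; exact ⟨h, hh, hne⟩)) (by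
    intro i hi
    simpa only [I, mem_filter, mem_univ, true_and] using hi)
  rw [Fintype.card_perm, Fintype.card_fin] at h1
  refine h1.trans ?_
  have hsh : ∀ i, ∃ S, Reach n S ∧ fn n S ≤ d i ∧
      ∀ α : ℕ → ℤ, IsPath α n → sta α n = S → ∃ v, (bOV φ i).IsWt (fun k => (α k : ℂ)) v := by
    intro i
    have : Nonempty (Fin (d i)) := ⟨⟨0, Nat.pos_of_ne_zero (hd0 i)⟩⟩
    have := OV.shape (O := bOV φ i)
    simpa using this
  choose S hS1 hS2 hS3 using hsh
  have hinj : Function.Injective S := by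
    intro i j hij
    by_contra hne
    obtain ⟨α, ha, hst⟩ := (hS1 i).path
    obtain ⟨v, hv⟩ := hS3 i α ha hst
    obtain ⟨u, hu⟩ := hS3 j α ha (hst.trans hij)
    refine inj_aux φ i j hne (fun k => (α k.val : ℂ)) (by intro k; simp) v u hv.1 hu.1 ?_ ?_
    · intro k
      have := hv.2 k.val k.2
      have e : (bOV φ i).X k.val = Tφ φ i (XN n k.val) := rfl
      rw [e, XN, dif_pos k.2] at this
      exact this
    · intro k
      have := hu.2 k.val k.2
      have e : (bOV φ j).X k.val = Tφ φ j (XN n k.val) := rfl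
      rw [e, XN, dif_pos k.2] at this
      exact this
  obtain ⟨g, hg⟩ : ∃ g, k / 2 = g + 1 := ⟨k/2 - 1, by omega⟩
  rw [hg]
  have e1 : ∀ i, (d i:ℝ)^2/(d i:ℝ)^(4*(g+1)) = (1/(d i:ℝ)^2)^(2*g+1) := by
    intro i
    have : (d i : ℝ) ≠ 0 := by exact_mod_cast hd0 i
    rw [one_div, inv_pow, ← pow_mul, div_eq_iff (by positivity), eq_comm, inv_mul_eq_iff_eq_mul₀ (by positivity),
      ← pow_add]
    congr 1; ring
  simp only [e1]
  rw [show 2 * (g+1) - 1 = 2 * g + 1 by omega]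
  refine (sum_pow_le' I _ (fun i _ => by positivity) _).trans ?_
  refine pow_le_pow_left₀ (Finset.sum_nonneg fun i _ => by positivity) ?_ _
  calc ∑ i ∈ I, 1/(d i:ℝ)^2 ≤ ∑ i ∈ I, qn n (S i) := by
        refine Finset.sum_le_sum fun i hi => ?_
        have hf : 2 ≤ fn n (S i) := by
          by_contra hcon
          have h1 : fn n (S i) = 1 := by have := fn_pos (hS1 i); omega
          have h2 := triv_of_fn_one φ i (hS1 i) h1 (hS3 i)
          simp only [I, mem_filter, mem_univ, true_and] at hi
          obtain ⟨h, hh, hne⟩ := hi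
          exact hne (h2 h hh)
        rw [qn, if_pos hf]
        have hp : (0:ℝ) < fn n (S i) := by exact_mod_cast (by omega : 0 < fn n (S i))
        have hle : (fn n (S i) : ℝ) ≤ d i := by exact_mod_cast hS2 i
        exact one_div_le_one_div_of_le (by positivity) (pow_le_pow_left₀ hp.le hle 2)
    _ = ∑ s ∈ I.image S, qn n s := by
        rw [Finset.sum_image]
        intro a _ b _ h; exact hinj h
    _ ≤ En n := by
        refine Finset.sum_le_sum_of_subset_of_nonneg ?_ fun s _ _ => qn_nonneg n s
        intro s hs
        rw [mem_image] at hs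
        obtain ⟨i, _, rfl⟩ := hs
        exact mem_Lv.2 (hS1 i)

/-- The total variation distance between the distribution of `w_c(σ_1,…,σ_k)` for
independent uniform `σ_1,…,σ_k ∈ S_n` and the uniform measure on the alternating
group `A_n` is `O(n^{-(k-1)})` for even `k` and `O(n^{-(k-2)})` for odd `k`. -/
theorem tv_wc_uniform (k : ℕ) (hk : 2 ≤ k) :
    ∃ C > (0 : ℝ), ∃ N : ℕ, ∀ n ≥ N, ∀ A : Set (Equiv.Perm (Fin n)),
      A ⊆ (alternatingGroup (Fin n) : Set (Equiv.Perm (Fin n))) →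
      |(Nat.card {v : Fin k → Equiv.Perm (Fin n) // wc v ∈ A} : ℝ)
            / (n.factorial : ℝ) ^ k
          - (Nat.card A : ℝ) / (Nat.card (alternatingGroup (Fin n)) : ℝ)|
        ≤ C / (n : ℝ) ^ (if Even k then k - 1 else k - 2) := by
  obtain ⟨K, hK, hE⟩ := En_bound
  have he : (if Even k then k - 1 else k - 2) = 2*(k/2)-1 := by
    split_ifs with h
    · obtain ⟨r, rfl⟩ := h; omega
    · rw [Nat.not_even_iff_odd] at h
      obtain ⟨r, rfl⟩ := h; omega
  rw [he]
  refine ⟨Real.sqrt (K^(2*(k/2)-1)), Real.sqrt_pos.2 (by positivity), 1, ?_⟩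
  intro n hn A hA
  have hn0 : (0:ℝ) < n := by exact_mod_cast hn
  apply abs_le_of_sq_le_sq _ (by positivity)
  refine (main_bound hk A hA).trans ?_
  rw [div_pow, Real.sq_sqrt (by positivity)]
  have h0 : 0 ≤ En n := Finset.sum_nonneg fun s _ => qn_nonneg n s
  refine (pow_le_pow_left₀ h0 (hE n hn) _).trans ?_
  rw [div_pow, ← pow_mul, ← pow_mul, mul_comm 2 (2*(k/2)-1)]
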